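/- arXiv:2002.05355 — 2 statements merged into one kernel-verified Lean document; each statement's English description precedes it below -/
import Mathlib

section
/- (Poincaré-type inequality) There is a universal constant C such that for every t ≥ 0 and every smooth function φ : ℝ³ → ℝ with compact support contained in {x : |x| ≥ t - R} (for some fixed R ≥ 1), one has ∫_{ℝ³} ⟨t - |x|⟩^{-2} |φ(x)|² dx ≤ C ∫_{ℝ³} |∇φ(x)|² dx, where ⟨s⟩ = (1 + s²)^{1/2} (or any comparable japanese bracket) and the constant C may depend on R but not on t or φ. -/
open MeasureTheory

/-- Euler field integrated against a compactly supported function. -/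
theorem aux_div (k : EuclideanSpace ℝ (Fin 3) → ℝ) (hk : ContDiff ℝ 1 k)
    (hc : HasCompactSupport k) :
    ∫ x : EuclideanSpace ℝ (Fin 3), (3 * k x + fderiv ℝ k x x) = 0 := by
  have hkd : Differentiable ℝ k := hk.differentiable (by norm_num)
  have key : ∀ i : Fin 3, Integrable (fun x : EuclideanSpace ℝ (Fin 3) =>
      k x + fderiv ℝ k x (EuclideanSpace.single i (1:ℝ)) * x i) ∧
      ∫ x : EuclideanSpace ℝ (Fin 3),
      (k x + fderiv ℝ k x (EuclideanSpace.single i (1:ℝ)) * x i) = 0 := by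
    intro i
    have hp : ContDiff ℝ 1 (fun x : EuclideanSpace ℝ (Fin 3) => x i) := by fun_prop
    have hm : ContDiff ℝ 1 (fun x : EuclideanSpace ℝ (Fin 3) => k x * x i) := hk.mul hp
    have hcm : HasCompactSupport (fun x : EuclideanSpace ℝ (Fin 3) => k x * x i) := hc.mul_right
    have e : (fun x : EuclideanSpace ℝ (Fin 3) =>
        k x + fderiv ℝ k x (EuclideanSpace.single i (1:ℝ)) * x i) =
        fun x => fderiv ℝ (fun x : EuclideanSpace ℝ (Fin 3) => k x * x i) x
          (EuclideanSpace.single i (1:ℝ)) := by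
      funext x
      have h1 : HasFDerivAt (fun x : EuclideanSpace ℝ (Fin 3) => x i)
          (EuclideanSpace.proj i : EuclideanSpace ℝ (Fin 3) →L[ℝ] ℝ) x :=
        (EuclideanSpace.proj i : EuclideanSpace ℝ (Fin 3) →L[ℝ] ℝ).hasFDerivAt
      have h2 : fderiv ℝ (fun x : EuclideanSpace ℝ (Fin 3) => k x * x i) x = _ :=
        ((hkd x).hasFDerivAt.mul h1).fderiv
      rw [h2]
      simp
      ring
    have hcont : Continuous (fun x => fderiv ℝ
        (fun x : EuclideanSpace ℝ (Fin 3) => k x * x i) x (EuclideanSpace.single i (1:ℝ))) :=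
      (hm.continuous_fderiv (by norm_num)).clm_apply continuous_const
    have hcc : HasCompactSupport (fun x => fderiv ℝ
        (fun x : EuclideanSpace ℝ (Fin 3) => k x * x i) x (EuclideanSpace.single i (1:ℝ))) :=
      hcm.fderiv_apply (𝕜 := ℝ) _
    have hint := hcont.integrable_of_hasCompactSupport (μ := volume) hcc
    rw [e]
    refine ⟨hint, ?_⟩
    have hib := integral_mul_fderiv_eq_neg_fderiv_mul_of_integrable (μ := volume)
      (f := fun _ : EuclideanSpace ℝ (Fin 3) => (1:ℝ))
      (g := fun x : EuclideanSpace ℝ (Fin 3) => k x * x i)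
      (v := EuclideanSpace.single i (1:ℝ)) (by simp) (by simpa using hint)
      (by simpa using hm.continuous.integrable_of_hasCompactSupport hcm)
      (fun x _ => differentiableAt_const _)
      (fun x _ => hm.differentiable (by norm_num) x)
    simpa using hib
  have e : (fun x : EuclideanSpace ℝ (Fin 3) => 3 * k x + fderiv ℝ k x x) =
      fun x => ∑ i : Fin 3, (k x + fderiv ℝ k x (EuclideanSpace.single i (1:ℝ)) * x i) := by
    funext x
    have hx : x = ∑ i : Fin 3, x i • EuclideanSpace.single i (1:ℝ) := by
      ext j
      fin_cases j <;> simp [Fin.sum_univ_three]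
    conv_lhs => rw [hx]
    rw [← hx]
    have : fderiv ℝ k x x = fderiv ℝ k x (∑ i : Fin 3, x i • EuclideanSpace.single i (1:ℝ)) := by
      rw [← hx]
    rw [this]
    simp [Fin.sum_univ_three]
    ring
  rw [e, integral_finsetSum _ (fun i _ => (key i).1)]
  simp [fun i => (key i).2]

theorem aux_core (φ : EuclideanSpace ℝ (Fin 3) → ℝ) (hφ : ContDiff ℝ (⊤ : ℕ∞) φ)
    (hc : HasCompactSupport φ) (w : EuclideanSpace ℝ (Fin 3) → ℝ) (hw : Continuous w)
    (G : ℝ → ℝ) (hk : ContDiff ℝ 1 (fun x => φ x ^ 2 * G ‖x‖))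
    (h : ∀ x, φ =ᶠ[nhds x] 0 ∨ ∃ G', (x ≠ 0 → HasDerivAt G G' ‖x‖) ∧
      w x + 3 * G ‖x‖ + ‖x‖ * G' + ‖x‖ ^ 2 * G ‖x‖ ^ 2 ≤ 0) :
    ∫ x, w x * φ x ^ 2 ≤ ∫ x, ‖fderiv ℝ φ x‖ ^ 2 := by
  set k : EuclideanSpace ℝ (Fin 3) → ℝ := fun x => φ x ^ 2 * G ‖x‖ with hkdef
  have hc2 : HasCompactSupport (fun x => φ x ^ 2) := by
    have : (fun x => φ x ^ 2) = fun x => φ x * φ x := by funext x; ring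
    rw [this]; exact hc.mul_right
  have hck : HasCompactSupport k := hc2.mul_right
  have hφd : Differentiable ℝ φ := hφ.differentiable (by simp)
  have i1 : Integrable (fun x => w x * φ x ^ 2) :=
    (hw.mul (hφ.continuous.pow 2)).integrable_of_hasCompactSupport hc2.mul_left
  have i2 : Integrable (fun x => 3 * k x + fderiv ℝ k x x) := by
    refine Continuous.integrable_of_hasCompactSupport ?_ ?_
    · exact (continuous_const.mul hk.continuous).add
        ((hk.continuous_fderiv (by norm_num)).clm_apply continuous_id)
    · refine HasCompactSupport.add hck.mul_left ?_
      refine (hck.fderiv (𝕜 := ℝ)).mono ?_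
      intro x hx hx'
      simp [hx'] at hx
  have i3 : Integrable (fun x => ‖fderiv ℝ φ x‖ ^ 2) := by
    refine Continuous.integrable_of_hasCompactSupport ?_ ?_
    · exact (hφ.continuous_fderiv (by simp)).norm.pow 2
    · refine (hc.fderiv (𝕜 := ℝ)).mono ?_
      intro x hx hx'
      simp [hx'] at hx
  have := integral_mono (i1.add i2) i3 (fun x => ?_)
  · simp only [Pi.add_apply] at this
    rw [integral_add i1 i2, aux_div k hk hck] at this
    simpa using this
  simp only [Pi.add_apply]
  rcases h x with h | ⟨G', hG, hle⟩
  · have hk0 : k =ᶠ[nhds x] fun _ => 0 := by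
      filter_upwards [h] with y hy
      simp [hkdef, hy]
    rw [hk0.fderiv_eq, hk0.eq_of_nhds, h.eq_of_nhds]
    simp
  · have hd : fderiv ℝ k x x = 2 * φ x * G ‖x‖ * fderiv ℝ φ x x + φ x ^ 2 * (‖x‖ * G') := by
      by_cases hx : x = 0
      · subst hx; simp
      have hn : DifferentiableAt ℝ (fun y : EuclideanSpace ℝ (Fin 3) => ‖y‖) x :=
        (contDiffAt_norm ℝ hx).differentiableAt (n := 1) (by norm_num)
      have h1 := (hG hx).comp_hasFDerivAt x hn.hasFDerivAt
      have h2 := ((hφd x).hasFDerivAt.pow 2).mul h1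
      have h3 : fderiv ℝ k x = _ := h2.fderiv
      rw [h3]
      have := DifferentiableAt.fderiv_norm_self hn
      simp [this]
      ring
    rw [hd]
    have hb : |fderiv ℝ φ x x| ≤ ‖fderiv ℝ φ x‖ * ‖x‖ := (fderiv ℝ φ x).le_opNorm x
    have hy : 2 * φ x * G ‖x‖ * fderiv ℝ φ x x ≤
        ‖fderiv ℝ φ x‖ ^ 2 + φ x ^ 2 * (‖x‖ ^ 2 * G ‖x‖ ^ 2) := by
      calc 2 * φ x * G ‖x‖ * fderiv ℝ φ x x ≤ |2 * φ x * G ‖x‖ * fderiv ℝ φ x x| := le_abs_self _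
        _ = 2 * |φ x * G ‖x‖| * |fderiv ℝ φ x x| := by
          rw [abs_mul, mul_assoc 2, abs_mul 2, abs_two]
        _ ≤ 2 * |φ x * G ‖x‖| * (‖fderiv ℝ φ x‖ * ‖x‖) := by gcongr
        _ ≤ ‖fderiv ℝ φ x‖ ^ 2 + |φ x * G ‖x‖| ^ 2 * ‖x‖ ^ 2 := by
          nlinarith [sq_nonneg (‖fderiv ℝ φ x‖ - |φ x * G ‖x‖| * ‖x‖)]
        _ = _ := by rw [sq_abs]; ring
    have := mul_nonpos_of_nonneg_of_nonpos (sq_nonneg (φ x)) hle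
    simp only [hkdef]
    nlinarith

/-- Poincaré-type inequality: for fixed `R ≥ 1` there is a constant `C`
(depending only on `R`) such that for every `t ≥ 0` and every smooth compactly
supported `φ : ℝ³ → ℝ` supported in `{|x| ≥ t - R}`,
`∫ ⟨t-|x|⟩⁻² φ² ≤ C ∫ |∇φ|²`. -/
theorem poincare_lemma (R : ℝ) (hR : 1 ≤ R) :
    ∃ C > 0, ∀ (t : ℝ), 0 ≤ t → ∀ φ : EuclideanSpace ℝ (Fin 3) → ℝ,
      ContDiff ℝ (⊤ : ℕ∞) φ → HasCompactSupport φ →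
      (∀ x, ‖x‖ < t - R → φ x = 0) →
      (∫ x : EuclideanSpace ℝ (Fin 3), ((1 + |t - ‖x‖|)^2)⁻¹ * (φ x)^2) ≤
        C * ∫ x : EuclideanSpace ℝ (Fin 3), ‖fderiv ℝ φ x‖^2 := by
  have hC : 0 < 4 * (R + 1) ^ 2 := by positivity
  refine ⟨4 * (R + 1) ^ 2, hC, ?_⟩
  intro t ht φ hφ hc hsupp
  have hφ1 : ContDiff ℝ 1 φ := hφ.of_le (by exact_mod_cast le_top)
  have hwc : Continuous (fun x : EuclideanSpace ℝ (Fin 3) =>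
      (4 * (R + 1) ^ 2)⁻¹ * ((1 + |t - ‖x‖|)^2)⁻¹) := by
    refine continuous_const.mul (Continuous.inv₀ (by fun_prop) ?_)
    intro x; positivity
  -- comparison of weights
  have hcomp : ∀ (r s : ℝ), 0 < s → s ≤ (R + 1) ^ 2 * (1 + |t - r|) ^ 2 →
      (4 * (R + 1) ^ 2)⁻¹ * ((1 + |t - r|)^2)⁻¹ ≤ 1 / (4 * s) := by
    intro r s hs hle
    rw [← mul_inv, ← one_div]
    apply one_div_le_one_div_of_le (by positivity)
    linarith
  suffices hmain : ∫ x : EuclideanSpace ℝ (Fin 3),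
      ((4 * (R + 1) ^ 2)⁻¹ * ((1 + |t - ‖x‖|)^2)⁻¹) * φ x ^ 2 ≤ ∫ x, ‖fderiv ℝ φ x‖ ^ 2 by
    simp_rw [mul_assoc] at hmain
    rw [integral_const_mul, inv_mul_le_iff₀ (by positivity)] at hmain
    simpa only [mul_assoc] using hmain
  rcases le_or_gt t R with htR | htR
  · -- smooth multiplier
    refine aux_core φ hφ hc _ hwc (fun r => -(2 * (1 + r ^ 2))⁻¹) ?_ ?_
    · refine (hφ1.pow 2).mul (ContDiff.neg (ContDiff.inv ?_ ?_))
      · exact contDiff_const.mul (contDiff_const.add (contDiff_norm_sq ℝ))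
      · intro x; positivity
    · intro x
      right
      set r := ‖x‖ with hr
      have hr0 : 0 ≤ r := norm_nonneg x
      have hp : 0 < 1 + r ^ 2 := by positivity
      refine ⟨r / (1 + r ^ 2) ^ 2, fun _ => ?_, ?_⟩
      · have h1 : HasDerivAt (fun r : ℝ => 2 * (1 + r ^ 2)) (2 * (2 * r)) r := by
          refine (((hasDerivAt_pow 2 r).const_add 1).const_mul 2).congr_deriv ?_
          norm_num
        refine (h1.inv (by positivity)).neg.congr_deriv ?_
        field_simp
      · have hle := hcomp r (1 + r ^ 2) hp (by
          have h0 : r ≤ t + |t - r| := by linarith [neg_abs_le (t - r)]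
          have ha := abs_nonneg (t - r)
          have h2 : 1 + r ≤ (R + 1) * (1 + |t - r|) := by nlinarith
          have h3 : (1 + r) ^ 2 ≤ ((R + 1) * (1 + |t - r|)) ^ 2 := by gcongr
          nlinarith)
        have : 1 / (4 * (1 + r ^ 2)) + 3 * (-(2 * (1 + r ^ 2))⁻¹) + r * (r / (1 + r ^ 2) ^ 2)
            + r ^ 2 * (-(2 * (1 + r ^ 2))⁻¹) ^ 2 = - 5 / (4 * (1 + r ^ 2) ^ 2) := by
          field_simp
          ring
        have h5 : - 5 / (4 * (1 + r ^ 2) ^ 2) ≤ 0 :=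
          div_nonpos_of_nonpos_of_nonneg (by norm_num) (by positivity)
        linarith
  · -- supported away from the origin
    have hloc : ∀ x : EuclideanSpace ℝ (Fin 3), ‖x‖ < t - R → φ =ᶠ[nhds x] 0 := by
      intro x hx
      filter_upwards [(isOpen_lt continuous_norm continuous_const).mem_nhds hx] with y hy
      exact hsupp y hy
    refine aux_core φ hφ hc _ hwc (fun r => (2 * (r - (t - R) + 1) * r)⁻¹ - (r ^ 2)⁻¹) ?_ ?_
    · rw [contDiff_iff_contDiffAt]
      intro x
      rcases lt_or_ge ‖x‖ (t - R) with hx | hx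
      · have : (fun x => φ x ^ 2 * ((2 * (‖x‖ - (t - R) + 1) * ‖x‖)⁻¹ - (‖x‖ ^ 2)⁻¹))
            =ᶠ[nhds x] fun _ => 0 := by
          filter_upwards [hloc x hx] with y hy
          simp [hy]
        exact contDiffAt_const.congr_of_eventuallyEq this
      · have hpos : 0 < ‖x‖ := by linarith
        have hn : ContDiffAt ℝ 1 (fun y : EuclideanSpace ℝ (Fin 3) => ‖y‖) x :=
          contDiffAt_norm ℝ (norm_pos_iff.mp hpos)
        have hs : 0 < ‖x‖ - (t - R) + 1 := by linarith
        refine (hφ1.contDiffAt.pow 2).mul (ContDiffAt.sub (ContDiffAt.inv ?_ ?_)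
          (ContDiffAt.inv ?_ ?_))
        · exact (contDiffAt_const.mul ((hn.sub contDiffAt_const).add contDiffAt_const)).mul hn
        · positivity
        · exact hn.pow 2
        · positivity
    · intro x
      rcases lt_or_ge ‖x‖ (t - R) with hx | hx
      · exact Or.inl (hloc x hx)
      right
      set r := ‖x‖ with hr
      have hpos : 0 < r := by linarith
      obtain ⟨s, hsdef⟩ : ∃ s, s = r - (t - R) + 1 := ⟨_, rfl⟩
      have hs : 0 < s := by linarith
      refine ⟨-(2 * s + 2 * r) / (2 * s * r) ^ 2 + 2 / r ^ 3, fun _ => ?_, ?_⟩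
      · have h1 : HasDerivAt (fun r : ℝ => 2 * (r - (t - R) + 1) * r) (2 * s + 2 * r) r := by
          refine (((((hasDerivAt_id r).sub_const (t - R)).add_const 1).const_mul 2).mul
            (hasDerivAt_id r)).congr_deriv ?_
          simp [hsdef]; ring
        have h2 : HasDerivAt (fun r : ℝ => r ^ 2) (2 * r) r := by
          simpa using hasDerivAt_pow 2 r
        refine ((h1.inv (by rw [← hsdef]; positivity)).sub
          (h2.inv (by positivity))).congr_deriv ?_
        rw [← hsdef]
        field_simp
        ring
      · have hle := hcomp r (s ^ 2) (by positivity) (by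
          have h0 : r - t ≤ |t - r| := by linarith [neg_abs_le (t - r)]
          have ha := abs_nonneg (t - r)
          have h2 : s ≤ (R + 1) * (1 + |t - r|) := by nlinarith
          have h3 : s ^ 2 ≤ ((R + 1) * (1 + |t - r|)) ^ 2 := by gcongr
          nlinarith)
        rw [← hsdef]
        have : 1 / (4 * s ^ 2) + 3 * ((2 * s * r)⁻¹ - (r ^ 2)⁻¹)
            + r * (-(2 * s + 2 * r) / (2 * s * r) ^ 2 + 2 / r ^ 3)
            + r ^ 2 * ((2 * s * r)⁻¹ - (r ^ 2)⁻¹) ^ 2 = 0 := by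
          field_simp
          ring
        linarith
end

section
/- (Klainerman–Sobolev inequality) There is a universal constant C such that for every smooth function φ(t,x) on ℝ^{1+3} that vanishes for large |x|, one has (1 + t + |x|)(1 + |t - |x||)^{1/2} |φ(t,x)| ≤ C Σ_{|I| ≤ 2} ‖Z^I φ(t,·)‖_{L²(ℝ³)}, where Z ranges over the vector fields ∂_α, the scaling S = t∂_t + r∂_r, the rotations Ω_{ij} = x_j∂_i - x_i∂_j, and the Lorentz boosts Ω_{0i} = x_i∂_t + t∂_i. -/
open MeasureTheory

noncomputable section

/-- Points of the spacetime `ℝ^{1+3}`. -/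
abbrev Pt := ℝ × EuclideanSpace ℝ (Fin 3)

/-- Time derivative `∂_t`. -/
def dt' (φ : Pt → ℝ) (p : Pt) : ℝ := fderiv ℝ φ p (1, 0)

/-- Spatial derivative `∂_i`. -/
def dx' (i : Fin 3) (φ : Pt → ℝ) (p : Pt) : ℝ :=
  fderiv ℝ φ p (0, EuclideanSpace.single i 1)

/-- Scaling vector field `S = t ∂_t + r ∂_r = t ∂_t + Σ xᵢ ∂_i`. -/
def scal' (φ : Pt → ℝ) (p : Pt) : ℝ := p.1 * dt' φ p + ∑ i, p.2 i * dx' i φ p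

/-- Rotation `Ω_{ij} = x_j ∂_i - x_i ∂_j`. -/
def rot' (i j : Fin 3) (φ : Pt → ℝ) (p : Pt) : ℝ :=
  p.2 j * dx' i φ p - p.2 i * dx' j φ p

/-- Lorentz boost `Ω_{0i} = x_i ∂_t + t ∂_i`. -/
def boost' (i : Fin 3) (φ : Pt → ℝ) (p : Pt) : ℝ :=
  p.2 i * dt' φ p + p.1 * dx' i φ p

/-- The list of commuting vector fields. -/
def CVFs : List ((Pt → ℝ) → Pt → ℝ) :=
  [dt', dx' 0, dx' 1, dx' 2, scal', rot' 0 1, rot' 0 2, rot' 1 2,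
   boost' 0, boost' 1, boost' 2]

/-- `Z^I φ` for a word `I` of vector fields. -/
def applyL : List ((Pt → ℝ) → Pt → ℝ) → (Pt → ℝ) → Pt → ℝ
  | [], φ => φ
  | Z :: L, φ => Z (applyL L φ)

/-- Spatial `L²` norm of `ψ(t, ·)`. -/
def L2n (ψ : Pt → ℝ) (t : ℝ) : ℝ :=
  Real.sqrt (∫ x : EuclideanSpace ℝ (Fin 3), (ψ (t, x))^2)



open Set

abbrev E3 := EuclideanSpace ℝ (Fin 3)

/-- unit vectors -/
def ee (i : Fin 3) : E3 := EuclideanSpace.single i 1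

/-- The eleven vector fields. -/
def KV : Fin 11 → Pt → Pt :=
  ![fun _ => (1, 0), fun _ => (0, ee 0), fun _ => (0, ee 1), fun _ => (0, ee 2),
    fun p => (p.1, p.2 0 • ee 0 + p.2 1 • ee 1 + p.2 2 • ee 2),
    fun p => (0, p.2 1 • ee 0 - p.2 0 • ee 1),
    fun p => (0, p.2 2 • ee 0 - p.2 0 • ee 2),
    fun p => (0, p.2 2 • ee 1 - p.2 1 • ee 2),
    fun p => (p.2 0, p.1 • ee 0), fun p => (p.2 1, p.1 • ee 1), fun p => (p.2 2, p.1 • ee 2)]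

def KZ (k : Fin 11) (φ : Pt → ℝ) (p : Pt) : ℝ := fderiv ℝ φ p (KV k p)

lemma lin_decomp (L : Pt →L[ℝ] ℝ) (a : ℝ) (v : E3) : L (a, v) = a * L (1, 0) + L (0, v) := by
  have : ((a, v) : Pt) = a • ((1, 0) : Pt) + (0, v) := by ext <;> simp
  rw [this, map_add, map_smul, smul_eq_mul]

lemma lin_add (L : Pt →L[ℝ] ℝ) (v w : E3) : L (0, v + w) = L (0, v) + L (0, w) := by
  rw [← map_add]; simp
lemma lin_sub (L : Pt →L[ℝ] ℝ) (v w : E3) : L (0, v - w) = L (0, v) - L (0, w) := by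
  rw [← map_sub]; simp
lemma lin_smul (L : Pt →L[ℝ] ℝ) (a : ℝ) (v : E3) : L (0, a • v) = a * L (0, v) := by
  rw [← smul_eq_mul, ← map_smul]; simp

lemma CVFs_eq : CVFs = List.ofFn KZ := by
  simp only [List.ofFn_succ, List.ofFn_zero, CVFs]
  have h0 : KZ 0 = dt' := rfl
  have h1 : KZ 1 = dx' 0 := rfl
  have h2 : KZ 2 = dx' 1 := rfl
  have h3 : KZ 3 = dx' 2 := rfl
  have h4 : KZ 4 = scal' := by
    funext φ p
    change fderiv ℝ φ p (p.1, p.2 0 • ee 0 + p.2 1 • ee 1 + p.2 2 • ee 2) = _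
    rw [lin_decomp, lin_add, lin_add, lin_smul, lin_smul, lin_smul]
    simp [scal', Fin.sum_univ_three, dt', dx', ee]
  have hr : ∀ (i j : Fin 3) (k : Fin 11), KV k = (fun p => (0, p.2 j • ee i - p.2 i • ee j)) →
      KZ k = rot' i j := by
    intro i j k h
    funext φ p
    simp only [KZ, h, rot', dx']
    rw [lin_sub, lin_smul, lin_smul]; rfl
  have hb : ∀ (i : Fin 3) (k : Fin 11), KV k = (fun p => (p.2 i, p.1 • ee i)) →
      KZ k = boost' i := by
    intro i k h
    funext φ p
    simp only [KZ, h, boost', dx', dt']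
    rw [lin_decomp, lin_smul]; rfl
  have h5 := hr 0 1 5 rfl
  have h6 := hr 0 2 6 rfl
  have h7 := hr 1 2 7 rfl
  have h8 := hb 0 8 rfl
  have h9 := hb 1 9 rfl
  have h10 := hb 2 10 rfl
  rw [← h0, ← h1, ← h2, ← h3, ← h4, ← h5, ← h6, ← h7, ← h8, ← h9, ← h10]
  rfl

lemma KV_smooth (k : Fin 11) : ContDiff ℝ (⊤ : ℕ∞) (KV k) := by
  fin_cases k <;> simp [KV] <;> fun_prop

def Good (φ : Pt → ℝ) : Prop :=
  ContDiff ℝ (⊤ : ℕ∞) φ ∧ ∃ M : ℝ, ∀ p : Pt, M ≤ ‖p.2‖ → φ p = 0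

lemma Good.KZ {φ : Pt → ℝ} (h : Good φ) (k : Fin 11) : Good (KZ k φ) := by
  obtain ⟨h, M, hM⟩ := h
  refine ⟨?_, M + 1, ?_⟩
  · have : ContDiff ℝ (⊤ : ℕ∞) (fderiv ℝ φ) := h.fderiv_right (by simp)
    exact this.clm_apply (KV_smooth k)
  · intro p hp
    have hev : φ =ᶠ[nhds p] fun _ => 0 := by
      have : ∀ᶠ q : Pt in nhds p, M < ‖q.2‖ := by
        have hc : Continuous fun q : Pt => ‖q.2‖ := by fun_prop
        exact hc.continuousAt.eventually (lt_mem_nhds (by linarith))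
      filter_upwards [this] with q hq using hM q hq.le
    simp [_root_.KZ, hev.fderiv_eq]

def Fsq (φ : Pt → ℝ) (p : Pt) : ℝ :=
  φ p ^ 2 + ∑ k, KZ k φ p ^ 2 + ∑ k, ∑ l, KZ k (KZ l φ) p ^ 2

lemma Fsq_nonneg (φ : Pt → ℝ) (p : Pt) : 0 ≤ Fsq φ p := by
  unfold Fsq; positivity

lemma Fsq_le0 (φ : Pt → ℝ) (p : Pt) : |φ p| ≤ √(Fsq φ p) := by
  apply Real.abs_le_sqrt
  unfold Fsq
  have : 0 ≤ ∑ k, KZ k φ p ^ 2 := by positivity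
  have : 0 ≤ ∑ k, ∑ l, KZ k (KZ l φ) p ^ 2 := by positivity
  linarith

lemma Fsq_le1 (φ : Pt → ℝ) (p : Pt) (k : Fin 11) : |KZ k φ p| ≤ √(Fsq φ p) := by
  apply Real.abs_le_sqrt
  unfold Fsq
  have := Finset.single_le_sum (f := fun k => KZ k φ p ^ 2) (fun i _ => sq_nonneg _) (Finset.mem_univ k)
  have : 0 ≤ ∑ k, ∑ l, KZ k (KZ l φ) p ^ 2 := by positivity
  have := sq_nonneg (φ p)
  linarith

lemma Fsq_le2 (φ : Pt → ℝ) (p : Pt) (k l : Fin 11) : |KZ k (KZ l φ) p| ≤ √(Fsq φ p) := by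
  apply Real.abs_le_sqrt
  unfold Fsq
  have h1 := Finset.single_le_sum (f := fun k => ∑ l, KZ k (KZ l φ) p ^ 2)
    (fun i _ => by positivity) (Finset.mem_univ k)
  have h2 := Finset.single_le_sum (f := fun l => KZ k (KZ l φ) p ^ 2)
    (fun i _ => by positivity) (Finset.mem_univ l)
  have : 0 ≤ ∑ k, KZ k φ p ^ 2 := by positivity
  have := sq_nonneg (φ p)
  linarith

lemma Good.integrable_sq {φ : Pt → ℝ} (h : Good φ) (t : ℝ) :
    Integrable (fun x : E3 => φ (t, x) ^ 2) := by
  obtain ⟨h, M, hM⟩ := h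
  have hc : Continuous φ := h.continuous
  apply Continuous.integrable_of_hasCompactSupport
  · fun_prop
  · apply HasCompactSupport.intro (isCompact_closedBall (0 : E3) M)
    intro x hx
    have : M ≤ ‖x‖ := by
      simp at hx; exact hx.le
    simp [hM (t, x) this]

/-- total energy -/
def En (φ : Pt → ℝ) (t : ℝ) : ℝ :=
  L2n φ t + ∑ k, L2n (KZ k φ) t + ∑ k, ∑ l, L2n (KZ k (KZ l φ)) t

lemma L2n_nonneg (φ : Pt → ℝ) (t : ℝ) : 0 ≤ L2n φ t := Real.sqrt_nonneg _

lemma En_nonneg (φ : Pt → ℝ) (t : ℝ) : 0 ≤ En φ t := by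
  unfold En
  have := L2n_nonneg
  have h1 : 0 ≤ ∑ k, L2n (KZ k φ) t := Finset.sum_nonneg fun i _ => this _ _
  have h2 : 0 ≤ ∑ k, ∑ l, L2n (KZ k (KZ l φ)) t :=
    Finset.sum_nonneg fun i _ => Finset.sum_nonneg fun i _ => this _ _
  have := this φ t
  linarith

lemma En_eq (φ : Pt → ℝ) (t : ℝ) : En φ t = (L2n φ t
            + (CVFs.map (fun Z => L2n (Z φ) t)).sum
            + (CVFs.map (fun Z₁ =>
                (CVFs.map (fun Z₂ => L2n (Z₁ (Z₂ φ)) t)).sum)).sum) := by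
  rw [CVFs_eq]
  simp only [List.map_ofFn, List.sum_ofFn, En, Function.comp_def]

lemma L2n_sq (φ : Pt → ℝ) (t : ℝ) : ∫ x : E3, φ (t, x) ^ 2 = L2n φ t ^ 2 := by
  unfold L2n
  rw [Real.sq_sqrt]
  exact integral_nonneg fun x => sq_nonneg _

lemma Fsq_int {φ : Pt → ℝ} (h : Good φ) (t : ℝ) :
    Integrable (fun x : E3 => Fsq φ (t, x)) ∧ ∫ x : E3, Fsq φ (t, x) ≤ En φ t ^ 2 := by
  have i0 := h.integrable_sq t
  have i1 : ∀ k, Integrable (fun x : E3 => KZ k φ (t, x) ^ 2) := fun k => (h.KZ k).integrable_sq t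
  have i2 : ∀ k l, Integrable (fun x : E3 => KZ k (KZ l φ) (t, x) ^ 2) :=
    fun k l => ((h.KZ l).KZ k).integrable_sq t
  have j1 : Integrable (fun x : E3 => ∑ k, KZ k φ (t, x) ^ 2) := integrable_finsetSum _ fun k _ => i1 k
  have j3 : ∀ k, Integrable (fun x : E3 => ∑ l, KZ k (KZ l φ) (t, x) ^ 2) :=
    fun k => integrable_finsetSum _ fun l _ => i2 k l
  have j2 : Integrable (fun x : E3 => ∑ k, ∑ l, KZ k (KZ l φ) (t, x) ^ 2) :=
    integrable_finsetSum _ fun k _ => j3 k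
  refine ⟨(i0.add j1).add j2, ?_⟩
  unfold Fsq
  have j01 : Integrable (fun x : E3 => φ (t, x) ^ 2 + ∑ k, KZ k φ (t, x) ^ 2) := i0.add j1
  rw [integral_add j01 j2, integral_add i0 j1, integral_finsetSum _ (fun k _ => i1 k),
    integral_finsetSum _ (fun k _ => j3 k)]
  simp_rw [fun k => integral_finsetSum Finset.univ (fun l _ => i2 k l), L2n_sq]
  have hn := L2n_nonneg
  have a1 : ∑ k, L2n (KZ k φ) t ^ 2 ≤ (∑ k, L2n (KZ k φ) t) ^ 2 :=
    Finset.sum_sq_le_sq_sum_of_nonneg (fun i _ => hn _ _)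
  have a2 : ∑ k, ∑ l, L2n (KZ k (KZ l φ)) t ^ 2 ≤ (∑ k, ∑ l, L2n (KZ k (KZ l φ)) t) ^ 2 := by
    refine le_trans (Finset.sum_le_sum fun k _ =>
      Finset.sum_sq_le_sq_sum_of_nonneg (fun i _ => hn _ _)) ?_
    exact Finset.sum_sq_le_sq_sum_of_nonneg
      (fun i _ => Finset.sum_nonneg fun i _ => hn _ _)
  have h1 : 0 ≤ ∑ k, L2n (KZ k φ) t := Finset.sum_nonneg fun i _ => hn _ _
  have h2 : 0 ≤ ∑ k, ∑ l, L2n (KZ k (KZ l φ)) t :=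
    Finset.sum_nonneg fun i _ => Finset.sum_nonneg fun i _ => hn _ _
  have h0 := hn φ t
  unfold En
  nlinarith [mul_nonneg h0 h1, mul_nonneg h0 h2, mul_nonneg h1 h2]


/-- One-dimensional weighted Sobolev inequality. -/
lemma oneD (h h1 G : ℝ → ℝ) (L : ℝ)
    (d0 : ∀ s ∈ Icc (0:ℝ) 1, HasDerivAt h (h1 s) s)
    (d1 : ∀ s ∈ Icc (0:ℝ) 1, HasDerivAt h1 (deriv h1 s) s)
    (hG : ContinuousOn G (Icc 0 1))
    (b0 : ∀ s ∈ Icc (0:ℝ) 1, |h s| ≤ L * √(G s))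
    (b1 : ∀ s ∈ Icc (0:ℝ) 1, |h1 s| ≤ L * √(G s))
    (b2 : ∀ s ∈ Icc (0:ℝ) 1, |deriv h1 s| ≤ L * √(G s))
    (hG0 : ∀ s, 0 ≤ G s) :
    h 0 ^ 2 ≤ (7 * L) ^ 2 * ∫ s in (0:ℝ)..1, s ^ 2 * G s := by
  set g2 : ℝ → ℝ := fun s => 2 * h s - 4 * (1 - s) * h1 s + (1 - s) ^ 2 * deriv h1 s with hg2
  have ch : ContinuousOn h (Icc 0 1) := fun s hs => (d0 s hs).continuousAt.continuousWithinAt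
  have ch1 : ContinuousOn h1 (Icc 0 1) := fun s hs => (d1 s hs).continuousAt.continuousWithinAt
  have bg : ∀ s ∈ Icc (0:ℝ) 1, |g2 s| ≤ 7 * L * √(G s) := by
    intro s hs
    have e0 := b0 s hs
    have e1 := b1 s hs
    have e2 := b2 s hs
    have k1 : |1 - s| ≤ 1 := by rw [abs_le]; constructor <;> linarith [hs.1, hs.2]
    have k2 : |(1 - s) ^ 2| ≤ 1 := by rw [abs_pow]; exact pow_le_one₀ (abs_nonneg _) k1
    calc |g2 s| ≤ |2 * h s - 4 * (1 - s) * h1 s| + |(1 - s) ^ 2 * deriv h1 s| := abs_add_le _ _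
      _ ≤ |2 * h s| + |4 * (1 - s) * h1 s| + |(1 - s) ^ 2 * deriv h1 s| := by
          gcongr; exact abs_sub _ _
      _ = 2 * |h s| + 4 * (|1 - s| * |h1 s|) + |(1 - s) ^ 2| * |deriv h1 s| := by
          simp only [abs_mul]; norm_num; ring
      _ ≤ 2 * |h s| + 4 * (1 * |h1 s|) + 1 * |deriv h1 s| := by gcongr
      _ ≤ _ := by linarith
  have mg : AEStronglyMeasurable g2 (volume.restrict (Icc 0 1)) := by
    have m0 : AEStronglyMeasurable h (volume.restrict (Icc 0 1)) :=
      ch.aestronglyMeasurable measurableSet_Icc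
    have m1 : AEStronglyMeasurable h1 (volume.restrict (Icc 0 1)) :=
      ch1.aestronglyMeasurable measurableSet_Icc
    have m2 : AEStronglyMeasurable (deriv h1) (volume.restrict (Icc 0 1)) :=
      (measurable_deriv h1).aestronglyMeasurable
    refine ((m0.const_mul 2).sub (AEStronglyMeasurable.mul ?_ m1)).add
      (AEStronglyMeasurable.mul ?_ m2)
    · exact (by fun_prop : Continuous fun s : ℝ => 4 * (1 - s)).aestronglyMeasurable
    · exact (by fun_prop : Continuous fun s : ℝ => (1 - s) ^ 2).aestronglyMeasurable
  obtain ⟨B, hB⟩ := (isCompact_Icc.image_of_continuousOn hG).isBounded.exists_norm_le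
  have hL : ∀ s ∈ Icc (0:ℝ) 1, |g2 s| ≤ 7 * |L| * √B := by
    intro s hs
    have : G s ≤ B := le_trans (le_abs_self _) (hB _ ⟨s, hs, rfl⟩)
    refine (bg s hs).trans ?_
    gcongr
    exact le_abs_self _
  have mS : AEStronglyMeasurable (fun s => s * g2 s) (volume.restrict (Icc 0 1)) :=
    continuous_id.aestronglyMeasurable.mul mg
  have bS : ∀ s ∈ Icc (0:ℝ) 1, |s * g2 s| ≤ 7 * |L| * √B := by
    intro s hs
    rw [abs_mul, abs_of_nonneg hs.1]
    have := hL s hs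
    nlinarith [abs_nonneg (g2 s), hs.2]
  have iS : IntegrableOn (fun s => s * g2 s) (Icc 0 1) := by
    refine IntegrableOn.of_bound (by simp) mS (7 * |L| * √B) ?_
    filter_upwards [ae_restrict_mem measurableSet_Icc] with s hs
    exact bS s hs
  have iS2 : IntegrableOn (fun s => (s * g2 s) ^ 2) (Icc 0 1) := by
    refine IntegrableOn.of_bound (by simp) (mS.pow 2) ((7 * |L| * √B) ^ 2) ?_
    filter_upwards [ae_restrict_mem measurableSet_Icc] with s hs
    rw [Real.norm_eq_abs, abs_pow]
    have := bS s hs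
    gcongr
  have iS' : IntervalIntegrable (fun s => s * g2 s) volume 0 1 := by
    rw [intervalIntegrable_iff_integrableOn_Icc_of_le zero_le_one]; exact iS
  have iS2' : IntervalIntegrable (fun s => (s * g2 s) ^ 2) volume 0 1 := by
    rw [intervalIntegrable_iff_integrableOn_Icc_of_le zero_le_one]; exact iS2
  have ftc : ∫ s in (0:ℝ)..1, s * g2 s = h 0 := by
    have := intervalIntegral.integral_eq_sub_of_hasDerivAt (a := (0:ℝ)) (b := 1)
      (f := fun s => s * (-2 * (1 - s) * h s + (1 - s) ^ 2 * h1 s) - (1 - s) ^ 2 * h s)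
      (f' := fun s => s * g2 s) ?_ iS'
    · rw [this]; ring
    · intro s hs
      rw [uIcc_of_le zero_le_one] at hs
      have a1 : HasDerivAt (fun s : ℝ => 1 - s) (-1) s := by
        simpa using (hasDerivAt_id s).const_sub 1
      have := (((hasDerivAt_id s).mul ((((a1.const_mul (-2)).mul (d0 s hs)).add
        ((a1.pow 2).mul (d1 s hs))))).sub ((a1.pow 2).mul (d0 s hs)))
      refine HasDerivAt.congr_deriv this ?_
      simp only [hg2, Pi.add_apply, Pi.mul_apply, Pi.pow_apply, id]
      norm_num only
      ring
  have cs : h 0 ^ 2 ≤ ∫ s in (0:ℝ)..1, (s * g2 s) ^ 2 := by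
    have : 0 ≤ ∫ s in (0:ℝ)..1, ((s * g2 s) ^ 2 - 2 * h 0 * (s * g2 s) + h 0 ^ 2) := by
      apply intervalIntegral.integral_nonneg zero_le_one
      intro s _
      nlinarith [sq_nonneg (s * g2 s - h 0)]
    rw [intervalIntegral.integral_add (iS2'.sub (iS'.const_mul _)) (by simp),
      intervalIntegral.integral_sub iS2' (iS'.const_mul _), intervalIntegral.integral_const_mul,
      ftc] at this
    simp at this
    nlinarith
  refine cs.trans ?_
  rw [← intervalIntegral.integral_const_mul]
  apply intervalIntegral.integral_mono_on zero_le_one iS2'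
  · apply ContinuousOn.intervalIntegrable
    rw [uIcc_of_le zero_le_one]
    fun_prop
  · intro s hs
    have := sq_le_sq' (neg_le_of_abs_le (bg s hs)) (le_of_abs_le (bg s hs))
    rw [mul_pow _ (√(G s)), Real.sq_sqrt (hG0 s)] at this
    nlinarith [sq_nonneg s]

def Nice (K : ℝ) (a : ℝ → ℝ) : Prop :=
  ∀ s ∈ Icc (0:ℝ) 1, DifferentiableAt ℝ a s ∧ |a s| ≤ K ∧ |deriv a s| ≤ K

/-- Admissible curves. -/
def Adm (K t : ℝ) (γ : ℝ → E3) : Prop :=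
  ∃ a : Fin 11 → ℝ → ℝ, (∀ k, Nice K (a k)) ∧
    ∀ s ∈ Icc (0:ℝ) 1, ∃ v : E3, HasDerivAt γ v s ∧ ((0, v) : Pt) = ∑ k, a k s • KV k (t, γ s)

lemma hasDeriv_along {φ : Pt → ℝ} (h : Good φ) {t s : ℝ} {γ : ℝ → E3} {v : E3}
    {a : Fin 11 → ℝ} (hv : HasDerivAt γ v s) (he : ((0, v) : Pt) = ∑ k, a k • KV k (t, γ s)) :
    HasDerivAt (fun s => φ (t, γ s)) (∑ k, a k * KZ k φ (t, γ s)) s := by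
  have hd : HasFDerivAt φ (fderiv ℝ φ (t, γ s)) (t, γ s) :=
    (h.1.differentiable (by simp)).differentiableAt.hasFDerivAt
  have hc : HasDerivAt (fun s => ((t, γ s) : Pt)) (0, v) s := (hasDerivAt_const s t).prodMk hv
  have := hd.comp_hasDerivAt s hc
  rw [he, map_sum] at this
  refine HasDerivAt.congr_deriv this ?_
  simp [KZ]

lemma Adm.bound {K t : ℝ} {γ : ℝ → E3} (hA : Adm K t γ) (hK : 1 ≤ K) {φ : Pt → ℝ} (h : Good φ) :
    φ (t, γ 0) ^ 2 ≤ (7 * (132 * K ^ 2)) ^ 2 * ∫ s in (0:ℝ)..1, s ^ 2 * Fsq φ (t, γ s) := by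
  obtain ⟨a, ha, hv⟩ := hA
  have d0 : ∀ s ∈ Icc (0:ℝ) 1, HasDerivAt (fun s => φ (t, γ s))
      (∑ k, a k s * KZ k φ (t, γ s)) s := by
    intro s hs
    obtain ⟨v, h1, h2⟩ := hv s hs
    exact hasDeriv_along h h1 h2
  have d1 : ∀ s ∈ Icc (0:ℝ) 1, HasDerivAt (fun s => ∑ k, a k s * KZ k φ (t, γ s))
      (∑ k, (deriv (a k) s * KZ k φ (t, γ s) +
        a k s * ∑ l, a l s * KZ l (KZ k φ) (t, γ s))) s := by
    intro s hs
    obtain ⟨v, h1, h2⟩ := hv s hs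
    apply HasDerivAt.fun_sum
    intro k _
    exact ((ha k s hs).1.hasDerivAt).mul (hasDeriv_along (h.KZ k) h1 h2)
  have cγ : ContinuousOn γ (Icc 0 1) := fun s hs => by
    obtain ⟨v, h1, h2⟩ := hv s hs
    exact h1.continuousAt.continuousWithinAt
  have cF : Continuous (Fsq φ) := by
    have c0 := h.1.continuous
    have c1 := fun k => (h.KZ k).1.continuous
    have c2 := fun k l => ((h.KZ l).KZ k).1.continuous
    unfold Fsq
    fun_prop
  have h11 : ∀ (c B : ℝ) (f : Fin 11 → ℝ), (∀ k, |f k| ≤ B) → |∑ k, f k| ≤ 11 * B := by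
    intro _ B f hf
    refine (Finset.abs_sum_le_sum_abs _ _).trans ((Finset.sum_le_sum fun k _ => hf k).trans ?_)
    simp
  have K2 : K ≤ K ^ 2 := by nlinarith
  have b1 : ∀ s ∈ Icc (0:ℝ) 1, |∑ k, a k s * KZ k φ (t, γ s)| ≤ 11 * (K * √(Fsq φ (t, γ s))) := by
    intro s hs
    apply h11 0
    intro k
    rw [abs_mul]
    exact mul_le_mul (ha k s hs).2.1 (Fsq_le1 φ _ k) (abs_nonneg _) (by linarith)
  refine oneD (fun s => φ (t, γ s)) _ (fun s => Fsq φ (t, γ s)) _ d0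
    (fun s hs => (d1 s hs).differentiableAt.hasDerivAt) ?_ ?_ ?_ ?_ (fun s => Fsq_nonneg _ _)
  · exact cF.comp_continuousOn (continuousOn_const.prodMk cγ)
  · intro s hs
    have := Fsq_le0 φ (t, γ s)
    have := Real.sqrt_nonneg (Fsq φ (t, γ s))
    nlinarith
  · intro s hs
    have := b1 s hs
    have := Real.sqrt_nonneg (Fsq φ (t, γ s))
    nlinarith
  · intro s hs
    rw [(d1 s hs).deriv]
    have e : |∑ k, (deriv (a k) s * KZ k φ (t, γ s) +
        a k s * ∑ l, a l s * KZ l (KZ k φ) (t, γ s))| ≤ 11 * (K * √(Fsq φ (t, γ s)) + 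
        K * (11 * (K * √(Fsq φ (t, γ s))))) := by
      apply h11 0
      intro k
      refine (abs_add_le _ _).trans ?_
      rw [abs_mul, abs_mul]
      refine add_le_add (mul_le_mul (ha k s hs).2.2 (Fsq_le1 φ _ k) (abs_nonneg _) (by linarith)) 
        (mul_le_mul (ha k s hs).2.1 ?_ (abs_nonneg _) (by linarith))
      apply h11 0
      intro l
      rw [abs_mul]
      exact mul_le_mul (ha l s hs).2.1 (Fsq_le2 φ _ l k) (abs_nonneg _) (by linarith)
    have := Real.sqrt_nonneg (Fsq φ (t, γ s))
    nlinarith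


def Q3 : Set (Fin 3 → ℝ) := Set.univ.pi fun _ => Ioo 0 1
def U2 : Set (Fin 2 → ℝ) := Set.univ.pi fun _ => Ioo 0 1

def PP (b : OrthonormalBasis (Fin 3) ℝ E3) (y : Fin 3 → ℝ) : E3 := b.repr.symm (WithLp.toLp 2 y)

lemma PP_mp (b : OrthonormalBasis (Fin 3) ℝ E3) : MeasurePreserving (PP b) :=
  b.measurePreserving_repr_symm.comp (PiLp.volume_preserving_toLp (Fin 3))

lemma PP_cont (b : OrthonormalBasis (Fin 3) ℝ E3) : Continuous (PP b) := by
  unfold PP; fun_prop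

lemma Fsq_cont {φ : Pt → ℝ} (h : Good φ) : Continuous (Fsq φ) := by
  have c0 := h.1.continuous
  have c1 := fun k => (h.KZ k).1.continuous
  have c2 := fun k l => ((h.KZ l).KZ k).1.continuous
  unfold Fsq
  fun_prop

lemma Q3_meas : MeasurableSet Q3 := MeasurableSet.univ_pi fun _ => measurableSet_Ioo
lemma U2_meas : MeasurableSet U2 := MeasurableSet.univ_pi fun _ => measurableSet_Ioo
lemma U2_vol : volume U2 = 1 := by
  unfold U2
  rw [volume_pi_pi]; simp

lemma cons_mem {s : ℝ} {u : Fin 2 → ℝ} (hs : s ∈ Ioo (0:ℝ) 1) (hu : u ∈ U2) :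
    (Fin.cons s u : Fin 3 → ℝ) ∈ Q3 := by
  intro i _
  refine Fin.cases ?_ ?_ i
  · simpa using hs
  · intro j; simpa using hu j (mem_univ _)

lemma tonelli (f : (Fin 3 → ℝ) → ENNReal) (hf : ContinuousOn f Q3) :
    ∫⁻ u in U2, ∫⁻ s in Ioo (0:ℝ) 1, f (Fin.cons s u) = ∫⁻ y in Q3, f y := by
  have mp := volume_preserving_piFinSuccAbove (fun _ : Fin 3 => ℝ) 0
  have hpre : (MeasurableEquiv.piFinSuccAbove (fun _ : Fin 3 => ℝ) 0) ⁻¹' (Ioo (0:ℝ) 1 ×ˢ U2) = Q3 := by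
    ext y
    simp only [mem_preimage, mem_prod, U2, Q3, mem_univ_pi]
    rw [Fin.forall_fin_succ (P := fun i : Fin 3 => y i ∈ Ioo (0:ℝ) 1)]
    rfl
  have e1 : ∀ y : Fin 3 → ℝ, f y = (fun p : ℝ × (Fin 2 → ℝ) => f (Fin.cons p.1 p.2))
      (MeasurableEquiv.piFinSuccAbove (fun _ : Fin 3 => ℝ) 0 y) := by
    intro y
    congr 1
    exact (Fin.cons_self_tail y).symm
  have cc : ContinuousOn (fun p : ℝ × (Fin 2 → ℝ) => f (Fin.cons p.1 p.2)) (Ioo (0:ℝ) 1 ×ˢ U2) := by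
    refine hf.comp (f := fun p : ℝ × (Fin 2 → ℝ) => (Fin.cons p.1 p.2 : Fin 3 → ℝ)) ?_ ?_
    · apply Continuous.continuousOn
      apply continuous_pi
      intro i
      refine Fin.cases ?_ ?_ i
      · simpa using continuous_fst
      · intro j
        simp only [Fin.cons_succ]
        fun_prop
    · rintro ⟨s, u⟩ ⟨h1, h2⟩
      exact cons_mem h1 h2
  have := mp.setLIntegral_comp_preimage_emb (MeasurableEquiv.measurableEmbedding _)
    (fun p : ℝ × (Fin 2 → ℝ) => f (Fin.cons p.1 p.2)) (Ioo (0:ℝ) 1 ×ˢ U2)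
  rw [hpre] at this
  simp_rw [← e1] at this
  rw [this, Measure.volume_eq_prod, ← Measure.prod_restrict, lintegral_prod_symm]
  rw [Measure.prod_restrict]
  exact cc.aemeasurable (measurableSet_Ioo.prod U2_meas)

theorem area (b : OrthonormalBasis (Fin 3) ℝ E3) (Ψ : (Fin 3 → ℝ) → (Fin 3 → ℝ))
    (M : (Fin 3 → ℝ) → Matrix (Fin 3) (Fin 3) ℝ) (J K t : ℝ) (x : E3) (hJ : 0 < J) (hK : 1 ≤ K)
    (hd : ∀ y ∈ Q3, HasFDerivAt Ψ (LinearMap.toContinuousLinearMap (Matrix.toLin' (M y))) y)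
    (hdet : ∀ y ∈ Q3, y 0 ^ 2 * J ≤ |(M y).det|)
    (hinj : InjOn Ψ Q3)
    (hA : ∀ u ∈ U2, Adm K t (fun s => PP b (Ψ (Fin.cons s u))))
    (h0 : ∀ u ∈ U2, PP b (Ψ (Fin.cons 0 u)) = x) {φ : Pt → ℝ} (h : Good φ) :
    J * φ (t, x) ^ 2 ≤ (7 * (132 * K ^ 2)) ^ 2 * En φ t ^ 2 := by
  set C : ℝ := (7 * (132 * K ^ 2)) ^ 2 with hC
  have hC0 : 0 ≤ C := sq_nonneg _
  set F : (Fin 3 → ℝ) → ENNReal := fun z => ENNReal.ofReal (Fsq φ (t, PP b z)) with hF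
  have cP := PP_cont b
  have cFs := Fsq_cont h
  have cF : Continuous F := by
    apply ENNReal.continuous_ofReal.comp; fun_prop
  have hFint := Fsq_int h t
  have iF : ∫⁻ z, F z ≤ ENNReal.ofReal (En φ t ^ 2) := by
    have e := (PP_mp b).lintegral_comp (f := fun x : E3 => ENNReal.ofReal (Fsq φ (t, x)))
      (ENNReal.continuous_ofReal.comp (by fun_prop)).measurable
    rw [hF, e, ← ofReal_integral_eq_lintegral_ofReal hFint.1 (Filter.Eventually.of_forall fun x => Fsq_nonneg _ _)]
    exact ENNReal.ofReal_le_ofReal hFint.2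
  have cΨ : ContinuousOn Ψ Q3 := fun y hy => (hd y hy).continuousAt.continuousWithinAt
  have main1 : ENNReal.ofReal (φ (t, x) ^ 2) ≤ ENNReal.ofReal C *
      ∫⁻ y in Q3, ENNReal.ofReal (y 0 ^ 2) * F (Ψ y) := by
    rw [← tonelli]
    · calc ENNReal.ofReal (φ (t, x) ^ 2) = ∫⁻ u in U2, ENNReal.ofReal (φ (t, x) ^ 2) := by
            simp [U2_vol]
        _ ≤ ∫⁻ u in U2, ENNReal.ofReal C * ∫⁻ s in Ioo (0:ℝ) 1,
            ENNReal.ofReal ((Fin.cons s u : Fin 3 → ℝ) 0 ^ 2) * F (Ψ (Fin.cons s u)) := by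
            apply setLIntegral_mono' U2_meas
            intro u hu
            have := (hA u hu).bound hK h
            simp only [h0 u hu] at this
            refine (ENNReal.ofReal_le_ofReal this).trans ?_
            rw [ENNReal.ofReal_mul hC0]
            gcongr
            obtain ⟨a, -, hv⟩ := hA u hu
            have cγ : ContinuousOn (fun s => PP b (Ψ (Fin.cons s u))) (Icc 0 1) := fun s hs => by
              obtain ⟨v, h1, h2⟩ := hv s hs
              exact h1.continuousAt.continuousWithinAt
            have cG : ContinuousOn (fun s : ℝ => s ^ 2 * Fsq φ (t, PP b (Ψ (Fin.cons s u)))) (Icc 0 1) := by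
              apply ContinuousOn.mul (by fun_prop)
              exact cFs.comp_continuousOn (continuousOn_const.prodMk cγ)
            rw [intervalIntegral.integral_of_le zero_le_one, integral_Ioc_eq_integral_Ioo,
              ofReal_integral_eq_lintegral_ofReal]
            · apply le_of_eq
              apply lintegral_congr
              intro s
              rw [ENNReal.ofReal_mul (sq_nonneg s)]
              rfl
            · exact (cG.integrableOn_Icc).mono_set Ioo_subset_Icc_self
            · exact Filter.Eventually.of_forall fun s => mul_nonneg (sq_nonneg s) (Fsq_nonneg _ _)
        _ = _ := lintegral_const_mul' _ _ ENNReal.ofReal_ne_top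
    · have e : (fun y : Fin 3 → ℝ => ENNReal.ofReal (y 0 ^ 2) * F (Ψ y)) =
          fun y => ENNReal.ofReal (y 0 ^ 2 * Fsq φ (t, PP b (Ψ y))) := by
        funext y; rw [ENNReal.ofReal_mul (sq_nonneg _)]
      rw [e]
      apply ENNReal.continuous_ofReal.comp_continuousOn
      apply ContinuousOn.mul (by fun_prop)
      exact cFs.comp_continuousOn (continuousOn_const.prodMk (cP.comp_continuousOn cΨ))
  have main2 : ENNReal.ofReal J * ∫⁻ y in Q3, ENNReal.ofReal (y 0 ^ 2) * F (Ψ y) ≤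
      ENNReal.ofReal (En φ t ^ 2) := by
    refine le_trans ?_ iF
    refine le_trans ?_ (setLIntegral_le_lintegral (Ψ '' Q3) F)
    rw [lintegral_image_eq_lintegral_abs_det_fderiv_mul volume Q3_meas
      (fun y hy => (hd y hy).hasFDerivWithinAt) hinj, ← lintegral_const_mul' _ _ ENNReal.ofReal_ne_top]
    apply setLIntegral_mono' Q3_meas
    intro y hy
    rw [← mul_assoc, ← ENNReal.ofReal_mul hJ.le]
    gcongr
    have : (LinearMap.toContinuousLinearMap (Matrix.toLin' (M y))).det = (M y).det := by
      simp [ContinuousLinearMap.det]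
    rw [this]
    linarith [hdet y hy]
  have fin : ENNReal.ofReal (J * φ (t, x) ^ 2) ≤ ENNReal.ofReal (C * En φ t ^ 2) := by
    rw [ENNReal.ofReal_mul hJ.le, ENNReal.ofReal_mul hC0]
    calc _ ≤ ENNReal.ofReal J * (ENNReal.ofReal C *
      ∫⁻ y in Q3, ENNReal.ofReal (y 0 ^ 2) * F (Ψ y)) := by gcongr
      _ = ENNReal.ofReal C * (ENNReal.ofReal J *
      ∫⁻ y in Q3, ENNReal.ofReal (y 0 ^ 2) * F (Ψ y)) := by ring
      _ ≤ _ := by gcongr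
  rwa [ENNReal.ofReal_le_ofReal_iff (by positivity)] at fin


lemma Nice.mono {K L : ℝ} {a : ℝ → ℝ} (h : Nice K a) (hKL : K ≤ L) : Nice L a :=
  fun s hs => ⟨(h s hs).1, (h s hs).2.1.trans hKL, (h s hs).2.2.trans hKL⟩

lemma Nice.of_deriv {K : ℝ} {a : ℝ → ℝ} (a' : ℝ → ℝ) (h : ∀ s ∈ Icc (0:ℝ) 1, HasDerivAt a (a' s) s)
    (h0 : ∀ s ∈ Icc (0:ℝ) 1, |a s| ≤ K) (h1 : ∀ s ∈ Icc (0:ℝ) 1, |a' s| ≤ K) : Nice K a :=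
  fun s hs => ⟨(h s hs).differentiableAt, h0 s hs, by rw [(h s hs).deriv]; exact h1 s hs⟩

lemma Nice.const {K c : ℝ} (h : |c| ≤ K) : Nice K (fun _ => c) :=
  Nice.of_deriv (fun _ => 0) (fun s _ => hasDerivAt_const s c) (fun _ _ => h)
    (fun _ _ => by simpa using (abs_nonneg c).trans h)

lemma Nice.add {K L : ℝ} {a b : ℝ → ℝ} (h : Nice K a) (h' : Nice L b) :
    Nice (K + L) (fun s => a s + b s) := by
  refine Nice.of_deriv (fun s => deriv a s + deriv b s)
    (fun s hs => (h s hs).1.hasDerivAt.add (h' s hs).1.hasDerivAt) (fun s hs => ?_) (fun s hs => ?_)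
  · exact (abs_add_le _ _).trans (add_le_add (h s hs).2.1 (h' s hs).2.1)
  · exact (abs_add_le _ _).trans (add_le_add (h s hs).2.2 (h' s hs).2.2)

lemma Nice.mul {K L : ℝ} {a b : ℝ → ℝ} (h : Nice K a) (h' : Nice L b) :
    Nice (2 * K * L) (fun s => a s * b s) := by
  refine Nice.of_deriv (fun s => deriv a s * b s + a s * deriv b s)
    (fun s hs => (h s hs).1.hasDerivAt.mul (h' s hs).1.hasDerivAt) (fun s hs => ?_) (fun s hs => ?_)
  · obtain ⟨-, h1, h2⟩ := h s hs
    obtain ⟨-, h3, h4⟩ := h' s hs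
    have hK := (abs_nonneg _).trans h1
    have hL := (abs_nonneg _).trans h3
    rw [abs_mul]
    have := mul_le_mul h1 h3 (abs_nonneg _) hK
    nlinarith
  · obtain ⟨-, h1, h2⟩ := h s hs
    obtain ⟨-, h3, h4⟩ := h' s hs
    have hK := (abs_nonneg _).trans h1
    have hL := (abs_nonneg _).trans h3
    have e1 := mul_le_mul h1 h4 (abs_nonneg _) hK
    have e2 := mul_le_mul h2 h3 (abs_nonneg _) hK
    refine (abs_add_le _ _).trans ?_
    rw [abs_mul, abs_mul]
    linarith

lemma Nice.neg {K : ℝ} {a : ℝ → ℝ} (h : Nice K a) : Nice K (fun s => - a s) := by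
  refine Nice.of_deriv (fun s => - deriv a s)
    (fun s hs => (h s hs).1.hasDerivAt.neg) (fun s hs => ?_) (fun s hs => ?_)
  · rw [abs_neg]; exact (h s hs).2.1
  · rw [abs_neg]; exact (h s hs).2.2

lemma Nice.nonneg {K : ℝ} {a : ℝ → ℝ} (h : Nice K a) : 0 ≤ K :=
  (abs_nonneg _).trans (h 0 (by simp)).2.1

lemma Nice.cos {u : ℝ} (h : |u| ≤ 1) : Nice 1 (fun s => Real.cos (s * u)) := by
  refine Nice.of_deriv (fun s => -Real.sin (s * u) * u)
    (fun s hs => ((hasDerivAt_mul_const u)).cos) (fun s hs => Real.abs_cos_le_one _) (fun s hs => ?_)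
  rw [abs_mul, abs_neg]
  exact mul_le_one₀ (Real.abs_sin_le_one _) (abs_nonneg _) h

lemma Nice.sin {u : ℝ} (h : |u| ≤ 1) : Nice 1 (fun s => Real.sin (s * u)) := by
  refine Nice.of_deriv (fun s => Real.cos (s * u) * u)
    (fun s hs => ((hasDerivAt_mul_const u)).sin) (fun s hs => Real.abs_sin_le_one _) (fun s hs => ?_)
  rw [abs_mul]
  exact mul_le_one₀ (Real.abs_cos_le_one _) (abs_nonneg _) h

/-- vector along the curve representable by the vector fields -/
def KRep (K t : ℝ) (γ : ℝ → E3) (W : ℝ → Pt) : Prop :=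
  ∃ a : Fin 11 → ℝ → ℝ, (∀ k, Nice K (a k)) ∧
    ∀ s ∈ Icc (0:ℝ) 1, W s = ∑ k, a k s • KV k (t, γ s)

lemma KRep.basic (t : ℝ) (γ : ℝ → E3) (k : Fin 11) : KRep 1 t γ (fun s => KV k (t, γ s)) := by
  refine ⟨fun l _ => if l = k then 1 else 0, fun l => Nice.const (by split_ifs <;> simp), ?_⟩
  intro s _
  simp

lemma KRep.add {K L t : ℝ} {γ : ℝ → E3} {W X : ℝ → Pt} (h : KRep K t γ W) (h' : KRep L t γ X) :
    KRep (K + L) t γ (fun s => W s + X s) := by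
  obtain ⟨a, ha, e⟩ := h
  obtain ⟨b, hb, e'⟩ := h'
  refine ⟨fun k s => a k s + b k s, fun k => (ha k).add (hb k), fun s hs => ?_⟩
  simp only [e s hs, e' s hs, add_smul, Finset.sum_add_distrib]

lemma KRep.smul {K L t : ℝ} {γ : ℝ → E3} {W : ℝ → Pt} {c : ℝ → ℝ} (hc : Nice K c) (h : KRep L t γ W) :
    KRep (2 * K * L) t γ (fun s => c s • W s) := by
  obtain ⟨a, ha, e⟩ := h
  refine ⟨fun k s => c s * a k s, fun k => hc.mul (ha k), fun s hs => ?_⟩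
  simp only [e s hs, mul_smul, Finset.smul_sum]

lemma KRep.mono {K L t : ℝ} {γ : ℝ → E3} {W : ℝ → Pt} (h : KRep K t γ W) (hKL : K ≤ L) : KRep L t γ W := by
  obtain ⟨a, ha, e⟩ := h
  exact ⟨a, fun k => (ha k).mono hKL, e⟩

lemma KRep.congr {K t : ℝ} {γ : ℝ → E3} {W X : ℝ → Pt} (h : KRep K t γ W)
    (e : ∀ s ∈ Icc (0:ℝ) 1, X s = W s) : KRep K t γ X := by
  obtain ⟨a, ha, e'⟩ := h
  exact ⟨a, ha, fun s hs => (e s hs).trans (e' s hs)⟩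

lemma KRep.adm {K t : ℝ} {γ v : ℝ → E3} (h : KRep K t γ (fun s => (0, v s)))
    (hv : ∀ s ∈ Icc (0:ℝ) 1, HasDerivAt γ (v s) s) : Adm K t γ := by
  obtain ⟨a, ha, e⟩ := h
  exact ⟨a, ha, fun s hs => ⟨v s, hv s hs, e s hs⟩⟩

lemma pt_ext {p q : Pt} (h : p.1 = q.1) (h0 : p.2 0 = q.2 0) (h1 : p.2 1 = q.2 1)
    (h2 : p.2 2 = q.2 2) : p = q := by
  refine Prod.ext h ?_
  ext i
  fin_cases i
  · exact h0
  · exact h1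
  · exact h2

lemma KV1 (p : Pt) : KV 1 p = (0, ee 0) := rfl
lemma KV2 (p : Pt) : KV 2 p = (0, ee 1) := rfl
lemma KV3 (p : Pt) : KV 3 p = (0, ee 2) := rfl
lemma KV4 (p : Pt) : KV 4 p = (p.1, p.2 0 • ee 0 + p.2 1 • ee 1 + p.2 2 • ee 2) := rfl
lemma KV5 (p : Pt) : KV 5 p = (0, p.2 1 • ee 0 - p.2 0 • ee 1) := rfl
lemma KV6 (p : Pt) : KV 6 p = (0, p.2 2 • ee 0 - p.2 0 • ee 2) := rfl
lemma KV7 (p : Pt) : KV 7 p = (0, p.2 2 • ee 1 - p.2 1 • ee 2) := rfl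
lemma KV8 (p : Pt) : KV 8 p = (p.2 0, p.1 • ee 0) := rfl
lemma KV9 (p : Pt) : KV 9 p = (p.2 1, p.1 • ee 1) := rfl
lemma KV10 (p : Pt) : KV 10 p = (p.2 2, p.1 • ee 2) := rfl

lemma ee_apply (i j : Fin 3) : ee i j = if j = i then 1 else 0 := by
  simp [ee]

/-- rotation in the plane spanned by `f, g` -/
lemma KRep.rot (t : ℝ) (γ : ℝ → E3) (f g : E3) (hf : ∀ i, |f i| ≤ 1) (hg : ∀ i, |g i| ≤ 1) :
    KRep 12 t γ (fun s => (0, (γ s 0 * f 0 + γ s 1 * f 1 + γ s 2 * f 2) • g -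
      (γ s 0 * g 0 + γ s 1 * g 1 + γ s 2 * g 2) • f)) := by
  have hm : ∀ i j, |f j * g i - f i * g j| ≤ 2 := by
    intro i j
    refine (abs_sub _ _).trans ?_
    rw [abs_mul, abs_mul]
    have := mul_le_one₀ (hf j) (abs_nonneg _) (hg i)
    have := mul_le_one₀ (hf i) (abs_nonneg _) (hg j)
    linarith
  have := (((KRep.basic t γ 5).smul (Nice.const (hm 0 1))).add
    ((KRep.basic t γ 6).smul (Nice.const (hm 0 2)))).add
    ((KRep.basic t γ 7).smul (Nice.const (hm 1 2)))
  refine (this.mono (by norm_num)).congr ?_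
  intro s _
  apply pt_ext <;> simp [KV5, KV6, KV7, ee_apply] <;> ring


lemma hasFDerivAt_mat {Ψ : (Fin 3 → ℝ) → (Fin 3 → ℝ)} {M : Matrix (Fin 3) (Fin 3) ℝ} {y : Fin 3 → ℝ}
    (h : ∀ i, ∃ L : (Fin 3 → ℝ) →L[ℝ] ℝ, HasFDerivAt (fun y => Ψ y i) L y ∧
      ∀ v, L v = M i 0 * v 0 + M i 1 * v 1 + M i 2 * v 2) :
    HasFDerivAt Ψ (LinearMap.toContinuousLinearMap (Matrix.toLin' M)) y := by
  rw [hasFDerivAt_pi']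
  intro i
  obtain ⟨L, h1, h2⟩ := h i
  refine h1.congr_fderiv ?_
  refine ContinuousLinearMap.ext fun v => ?_
  simp only [ContinuousLinearMap.comp_apply, ContinuousLinearMap.proj_apply,
    LinearMap.coe_toContinuousLinearMap', Matrix.toLin'_apply, Matrix.mulVec, dotProduct,
    Fin.sum_univ_three, h2]

lemma hc (y : Fin 3 → ℝ) (i : Fin 3) : HasFDerivAt (fun y : Fin 3 → ℝ => y i)
    (ContinuousLinearMap.proj (R := ℝ) (φ := fun _ : Fin 3 => ℝ) i) y := hasFDerivAt_apply i y

def wv (u : Fin 2 → ℝ) : E3 := !₂[1, u 0, u 1]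

lemma PP_basisFun (y : Fin 3 → ℝ) : PP (EuclideanSpace.basisFun (Fin 3) ℝ) y = WithLp.toLp 2 y := by
  rw [PP, LinearIsometryEquiv.symm_apply_eq]
  ext i
  simp

lemma PP_apply (b : OrthonormalBasis (Fin 3) ℝ E3) (y : Fin 3 → ℝ) :
    PP b y = y 0 • b 0 + y 1 • b 1 + y 2 • b 2 := by
  unfold PP
  rw [← b.sum_repr_symm, Fin.sum_univ_three]

lemma cons1 (s : ℝ) (u : Fin 2 → ℝ) : (Fin.cons s u : Fin 3 → ℝ) 1 = u 0 := rfl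
lemma cons2 (s : ℝ) (u : Fin 2 → ℝ) : (Fin.cons s u : Fin 3 → ℝ) 2 = u 1 := rfl
lemma cons0 (s : ℝ) (u : Fin 2 → ℝ) : (Fin.cons s u : Fin 3 → ℝ) 0 = s := rfl

theorem straight (x : E3) (R t K : ℝ) (hR : 0 < R) (hK : 1 ≤ K)
    (hA : ∀ u ∈ U2, Adm K t (fun s => x + (R * s) • wv u)) {φ : Pt → ℝ} (h : Good φ) :
    R ^ 3 * φ (t, x) ^ 2 ≤ (7 * (132 * K ^ 2)) ^ 2 * En φ t ^ 2 := by
  have key : ∀ (s : ℝ) (u : Fin 2 → ℝ), PP (EuclideanSpace.basisFun (Fin 3) ℝ)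
      ((fun y : Fin 3 → ℝ => ![x 0 + R * y 0, x 1 + R * (y 0 * y 1), x 2 + R * (y 0 * y 2)])
        (Fin.cons s u)) = x + (R * s) • wv u := by
    intro s u
    rw [PP_basisFun]
    ext i
    fin_cases i <;> simp [wv, cons1, cons2, cons0] <;> ring
  refine area (EuclideanSpace.basisFun (Fin 3) ℝ)
    (fun y => ![x 0 + R * y 0, x 1 + R * (y 0 * y 1), x 2 + R * (y 0 * y 2)])
    (fun y => !![R, 0, 0; R * y 1, R * y 0, 0; R * y 2, 0, R * y 0]) (R ^ 3) K t x (by positivity) hK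
    ?_ ?_ ?_ ?_ ?_ h
  · intro y _
    apply hasFDerivAt_mat
    intro i
    fin_cases i
    · exact ⟨_, ((hc y 0).const_mul R).const_add _, fun v => by simp⟩
    · exact ⟨_, (((hc y 0).mul (hc y 1)).const_mul R).const_add _, fun v => by simp; ring⟩
    · exact ⟨_, (((hc y 0).mul (hc y 2)).const_mul R).const_add _, fun v => by simp; ring⟩
  · intro y _
    rw [Matrix.det_fin_three]
    simp
    rw [abs_of_pos hR]
    apply le_of_eq
    rw [← sq_abs (y 0)]; ring
  · intro y hy z hz e
    have e0 := congrFun e 0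
    have e1 := congrFun e 1
    have e2 := congrFun e 2
    simp [hR.ne'] at e0 e1 e2
    rw [e0] at e1 e2
    have : z 0 ≠ 0 := (hz 0 (mem_univ _)).1.ne'
    simp [this] at e1 e2
    ext i
    fin_cases i
    · exact e0
    · exact e1
    · exact e2
  · intro u hu
    simp only [key]
    exact hA u hu
  · intro u hu
    rw [key]; simp

lemma U2_abs {u : Fin 2 → ℝ} (hu : u ∈ U2) (i : Fin 2) : |u i| ≤ 1 := by
  have := hu i (mem_univ _)
  rw [abs_le]; constructor <;> linarith [this.1, this.2]

lemma wv_abs {u : Fin 2 → ℝ} (hu : u ∈ U2) (i : Fin 3) : |wv u i| ≤ 1 := by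
  fin_cases i
  · simp [wv]
  · exact U2_abs hu 0
  · exact U2_abs hu 1

lemma line_deriv (x w : E3) (R s : ℝ) : HasDerivAt (fun s : ℝ => x + (R * s) • w) (R • w) s := by
  have := (((hasDerivAt_id s).const_mul R).smul_const w).const_add x
  simpa using this

theorem region0 (x : E3) (t : ℝ) {φ : Pt → ℝ} (h : Good φ) :
    (1:ℝ) ^ 3 * φ (t, x) ^ 2 ≤ (7 * (132 * (10000:ℝ) ^ 2)) ^ 2 * En φ t ^ 2 := by
  refine straight x 1 t 10000 one_pos (by norm_num) ?_ h
  intro u hu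
  refine KRep.adm (v := fun _ => (1:ℝ) • wv u) ?_ (fun s _ => line_deriv x (wv u) 1 s)
  set γ : ℝ → E3 := fun s => x + (1 * s) • wv u
  have := (((KRep.basic t γ 1).smul (Nice.const (wv_abs hu 0))).add
    ((KRep.basic t γ 2).smul (Nice.const (wv_abs hu 1)))).add
    ((KRep.basic t γ 3).smul (Nice.const (wv_abs hu 2)))
  refine (this.mono (by norm_num)).congr ?_
  intro s _
  apply pt_ext <;> simp [KV1, KV2, KV3, ee_apply]

theorem region1 (x : E3) (t : ℝ) (ht : 1 ≤ t) (hx : ‖x‖ ≤ t / 2) {φ : Pt → ℝ} (h : Good φ) :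
    (t / 8) ^ 3 * φ (t, x) ^ 2 ≤ (7 * (132 * (10000:ℝ) ^ 2)) ^ 2 * En φ t ^ 2 := by
  have ht0 : 0 < t := by linarith
  refine straight x (t / 8) t 10000 (by positivity) (by norm_num) ?_ h
  intro u hu
  refine KRep.adm (v := fun _ => (t / 8) • wv u) ?_ (fun s _ => line_deriv x (wv u) (t / 8) s)
  set γ : ℝ → E3 := fun s => x + (t / 8 * s) • wv u with hγ
  set w := wv u with hw
  have hw1 := wv_abs hu
  rw [← hw] at hw1
  have hxn : (x 0 / t) ^ 2 + (x 1 / t) ^ 2 + (x 2 / t) ^ 2 ≤ 1 / 4 := by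
    have h1 : ‖x‖ ^ 2 ≤ (t / 2) ^ 2 := by gcongr
    rw [EuclideanSpace.norm_sq_eq, Fin.sum_univ_three] at h1
    simp only [Real.norm_eq_abs, sq_abs] at h1
    rw [div_pow, div_pow, div_pow, ← add_div, ← add_div, div_le_iff₀ (by positivity)]
    linarith
  set g : Fin 3 → ℝ → ℝ := fun i s => x i / t + s * (w i / 8) with hg
  have hgd : ∀ i s, HasDerivAt (g i) (w i / 8) s := fun i s =>
    (hasDerivAt_mul_const (w i / 8)).const_add _
  have hgs : ∀ s ∈ Icc (0:ℝ) 1, g 0 s ^ 2 + g 1 s ^ 2 + g 2 s ^ 2 ≤ 9 / 16 := by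
    intro s hs
    have key : ∀ i, g i s ^ 2 ≤ 3 / 2 * (x i / t) ^ 2 + 3 / 64 := by
      intro i
      have hb : (s * (w i / 8)) ^ 2 ≤ 1 / 64 := by
        have : |s * w i| ≤ 1 := by
          rw [abs_mul]
          exact mul_le_one₀ (by rw [abs_le]; constructor <;> linarith [hs.1, hs.2]) (abs_nonneg _) (hw1 i)
        have := (sq_le_one_iff_abs_le_one _).2 this
        nlinarith
      simp only [hg]
      nlinarith [sq_nonneg (x i / t - 2 * (s * (w i / 8)))]
    linarith [key 0, key 1, key 2]
  have hgi : ∀ s ∈ Icc (0:ℝ) 1, ∀ i, |g i s| ≤ 1 := by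
    intro s hs i
    rw [← sq_le_one_iff_abs_le_one]
    have := hgs s hs
    have a0 := sq_nonneg (g 0 s)
    have a1 := sq_nonneg (g 1 s)
    have a2 := sq_nonneg (g 2 s)
    fin_cases i <;> simp only [Fin.zero_eta, Fin.mk_one, Fin.reduceFinMk] <;> linarith
  have ng : ∀ i, Nice 1 (g i) := fun i => Nice.of_deriv (fun _ => w i / 8) (fun s _ => hgd i s)
    (fun s hs => hgi s hs i) (fun s hs => by
      rw [abs_div]; have := hw1 i; norm_num; linarith)
  set D : ℝ → ℝ := fun s => (1 - (g 0 s ^ 2 + g 1 s ^ 2 + g 2 s ^ 2))⁻¹ with hD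
  have hDp : ∀ s ∈ Icc (0:ℝ) 1, 7 / 16 ≤ 1 - (g 0 s ^ 2 + g 1 s ^ 2 + g 2 s ^ 2) := by
    intro s hs; linarith [hgs s hs]
  have hD3 : ∀ s ∈ Icc (0:ℝ) 1, |D s| ≤ 3 := by
    intro s hs
    have := hDp s hs
    rw [hD, abs_inv, abs_of_pos (by linarith)]
    rw [inv_le_comm₀ (by linarith) (by norm_num)]
    linarith
  have nD : Nice 27 D := by
    refine Nice.of_deriv (fun s => - (-(2 * g 0 s * (w 0 / 8) + 2 * g 1 s * (w 1 / 8) + 2 * g 2 s * (w 2 / 8))) /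
      (1 - (g 0 s ^ 2 + g 1 s ^ 2 + g 2 s ^ 2)) ^ 2) ?_ (fun s hs => (hD3 s hs).trans (by norm_num)) ?_
    · intro s hs
      have := hDp s hs
      have := (((((hgd 0 s).pow 2).add ((hgd 1 s).pow 2)).add ((hgd 2 s).pow 2)).const_sub 1).inv 
        (by simp; linarith)
      refine HasDerivAt.congr_deriv this ?_
      simp
    · intro s hs
      have e : ∀ i, |2 * g i s * (w i / 8)| ≤ 1 := by
        intro i
        rw [abs_mul, abs_mul, abs_div]
        have := mul_le_one₀ (hgi s hs i) (abs_nonneg _) (hw1 i)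
        norm_num
        linarith
      have e3 : |2 * g 0 s * (w 0 / 8) + 2 * g 1 s * (w 1 / 8) + 2 * g 2 s * (w 2 / 8)| ≤ 3 := by
        refine (abs_add_three _ _ _).trans ?_
        linarith [e 0, e 1, e 2]
      rw [neg_neg, div_eq_mul_inv, ← inv_pow, abs_mul, abs_pow]
      have := hD3 s hs
      calc _ ≤ 3 * (3:ℝ) ^ 2 := by gcongr
        _ = 27 := by norm_num
  have nw : ∀ i, Nice 1 (fun _ => w i / 8) := fun i => Nice.const (by
    rw [abs_div]; have := hw1 i; norm_num; linarith)
  have nA : ∀ i, Nice 54 (fun s => w i / 8 * D s) := fun i => ((nw i).mul nD).mono (by norm_num)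
  have nB : ∀ i j, Nice 108 (fun s => -(w i / 8 * D s * g j s)) := fun i j =>
    (((nA i).mul (ng j)).neg).mono (by norm_num)
  have nC : ∀ i j, Nice 216 (fun s => -(w i / 8 * D s * g j s) + -(-(w j / 8 * D s * g i s))) :=
    fun i j => ((nB i j).add (nB j i).neg).mono (by norm_num)
  have := ((((((KRep.basic t γ 8).smul (nA 0)).add ((KRep.basic t γ 9).smul (nA 1))).add
    ((KRep.basic t γ 10).smul (nA 2))).add
    ((KRep.basic t γ 4).smul (((nB 0 0).add (nB 1 1)).add (nB 2 2)))).add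
    (((KRep.basic t γ 5).smul (nC 0 1)).add ((KRep.basic t γ 6).smul (nC 0 2)))).add
    ((KRep.basic t γ 7).smul (nC 1 2))
  refine (this.mono (by norm_num)).congr ?_
  intro s hs
  have hDD : D s * (1 - (g 0 s ^ 2 + g 1 s ^ 2 + g 2 s ^ 2)) = 1 := by
    have := hDp s hs
    rw [hD]; exact inv_mul_cancel₀ (by linarith)
  have hγg : ∀ i, γ s i = t * g i s := by
    intro i
    simp [hγ, hg]
    field_simp
  apply pt_ext <;> simp [KV4, KV5, KV6, KV7, KV8, KV9, KV10, ee_apply, hγg]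
  · ring
  · linear_combination (-t * w 0 / 8) * hDD
  · linear_combination (-t * w 1 / 8) * hDD
  · linear_combination (-t * w 2 / 8) * hDD


def nv (b : OrthonormalBasis (Fin 3) ℝ E3) (u : Fin 2 → ℝ) (s : ℝ) : E3 :=
  (Real.cos (s * u 1) * Real.cos (s * u 0)) • b 0 + (Real.cos (s * u 1) * Real.sin (s * u 0)) • b 1
    + Real.sin (s * u 1) • b 2

lemma b_abs (b : OrthonormalBasis (Fin 3) ℝ E3) (a i : Fin 3) : |b a i| ≤ 1 := by
  have h1 : ‖b a‖ = 1 := b.orthonormal.1 a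
  have := PiLp.norm_apply_le (b a) i
  rw [h1] at this
  simpa using this

lemma b_dot (b : OrthonormalBasis (Fin 3) ℝ E3) (a c : Fin 3) :
    b a 0 * b c 0 + b a 1 * b c 1 + b a 2 * b c 2 = if a = c then 1 else 0 := by
  have := (orthonormal_iff_ite.1 b.orthonormal) a c
  rw [← this]
  simp [PiLp.inner_apply, Fin.sum_univ_three]
  ring

lemma nv_nice (b : OrthonormalBasis (Fin 3) ℝ E3) {u : Fin 2 → ℝ} (hu : u ∈ U2) (i : Fin 3) :
    Nice 10 (fun s => nv b u s i) := by
  have c0 := Nice.cos (U2_abs hu 0)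
  have s0 := Nice.sin (U2_abs hu 0)
  have c1 := Nice.cos (U2_abs hu 1)
  have s1 := Nice.sin (U2_abs hu 1)
  have := (((c1.mul c0).mul (Nice.const (b_abs b 0 i))).add ((c1.mul s0).mul (Nice.const (b_abs b 1 i)))).add
    (s1.mul (Nice.const (b_abs b 2 i)))
  have h2 := this.mono (L := 10) (by norm_num)
  convert h2 using 2
  simp [nv]

lemma nv_dot0 (b : OrthonormalBasis (Fin 3) ℝ E3) (u : Fin 2 → ℝ) (s : ℝ) :
    nv b u s 0 * b 0 0 + nv b u s 1 * b 0 1 + nv b u s 2 * b 0 2 =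
      Real.cos (s * u 1) * Real.cos (s * u 0) := by
  have h0 := b_dot b 0 0
  have h1 := b_dot b 1 0
  have h2 := b_dot b 2 0
  simp at h0 h1 h2
  simp [nv]
  linear_combination (Real.cos (s * u 1) * Real.cos (s * u 0)) * h0 +
    (Real.cos (s * u 1) * Real.sin (s * u 0)) * h1 + Real.sin (s * u 1) * h2

lemma nv_dot1 (b : OrthonormalBasis (Fin 3) ℝ E3) (u : Fin 2 → ℝ) (s : ℝ) :
    nv b u s 0 * b 1 0 + nv b u s 1 * b 1 1 + nv b u s 2 * b 1 2 =
      Real.cos (s * u 1) * Real.sin (s * u 0) := by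
  have h0 := b_dot b 0 1
  have h1 := b_dot b 1 1
  have h2 := b_dot b 2 1
  simp at h0 h1 h2
  simp [nv]
  linear_combination (Real.cos (s * u 1) * Real.cos (s * u 0)) * h0 +
    (Real.cos (s * u 1) * Real.sin (s * u 0)) * h1 + Real.sin (s * u 1) * h2

lemma nv_dot2 (b : OrthonormalBasis (Fin 3) ℝ E3) (u : Fin 2 → ℝ) (s : ℝ) :
    nv b u s 0 * b 2 0 + nv b u s 1 * b 2 1 + nv b u s 2 * b 2 2 =
      Real.sin (s * u 1) := by
  have h0 := b_dot b 0 2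
  have h1 := b_dot b 1 2
  have h2 := b_dot b 2 2
  simp at h0 h1 h2
  simp [nv]
  linear_combination (Real.cos (s * u 1) * Real.cos (s * u 0)) * h0 +
    (Real.cos (s * u 1) * Real.sin (s * u 0)) * h1 + Real.sin (s * u 1) * h2

lemma nv_sq (b : OrthonormalBasis (Fin 3) ℝ E3) (u : Fin 2 → ℝ) (s : ℝ) :
    nv b u s 0 ^ 2 + nv b u s 1 ^ 2 + nv b u s 2 ^ 2 = 1 := by
  have h0 := nv_dot0 b u s
  have h1 := nv_dot1 b u s
  have h2 := nv_dot2 b u s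
  have e : ∀ i, nv b u s i = (Real.cos (s * u 1) * Real.cos (s * u 0)) * b 0 i +
    (Real.cos (s * u 1) * Real.sin (s * u 0)) * b 1 i + Real.sin (s * u 1) * b 2 i := by
    intro i; simp [nv]
  have A := Real.cos_sq_add_sin_sq (s * u 1)
  have B := Real.cos_sq_add_sin_sq (s * u 0)
  calc nv b u s 0 ^ 2 + nv b u s 1 ^ 2 + nv b u s 2 ^ 2
      = (Real.cos (s * u 1) * Real.cos (s * u 0)) * (nv b u s 0 * b 0 0 + nv b u s 1 * b 0 1 + nv b u s 2 * b 0 2)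
        + (Real.cos (s * u 1) * Real.sin (s * u 0)) * (nv b u s 0 * b 1 0 + nv b u s 1 * b 1 1 + nv b u s 2 * b 1 2)
        + Real.sin (s * u 1) * (nv b u s 0 * b 2 0 + nv b u s 1 * b 2 1 + nv b u s 2 * b 2 2) := by
        linear_combination (nv b u s 0) * e 0 + (nv b u s 1) * e 1 + (nv b u s 2) * e 2
    _ = 1 := by
        rw [h0, h1, h2]
        linear_combination Real.cos (s * u 1) ^ 2 * B + A

lemma curve_adm (b : OrthonormalBasis (Fin 3) ℝ E3) {u : Fin 2 → ℝ} (hu : u ∈ U2) (r κ t : ℝ)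
    (hrad : KRep 1000 t (fun s => (r + κ * s) • nv b u s) (fun s => (0, κ • nv b u s))) :
    Adm 10000 t (fun s => (r + κ * s) • nv b u s) := by
  refine KRep.adm (v := fun s => κ • nv b u s + (r + κ * s) •
    ((-Real.sin (s * u 1) * u 1 * Real.cos (s * u 0) + Real.cos (s * u 1) * (-Real.sin (s * u 0) * u 0)) • b 0
      + (-Real.sin (s * u 1) * u 1 * Real.sin (s * u 0) + Real.cos (s * u 1) * (Real.cos (s * u 0) * u 0)) • b 1
      + (Real.cos (s * u 1) * u 1) • b 2)) ?_ ?_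
  · set γ : ℝ → E3 := fun s => (r + κ * s) • nv b u s with hγ
    have c0 := Nice.cos (U2_abs hu 0)
    have s0 := Nice.sin (U2_abs hu 0)
    have := ((hrad.add ((KRep.rot t γ (b 0) (b 1) (b_abs b 0) (b_abs b 1)).smul (Nice.const (U2_abs hu 0)))).add
      ((KRep.rot t γ (b 0) (b 2) (b_abs b 0) (b_abs b 2)).smul ((Nice.const (U2_abs hu 1)).mul c0))).add
      ((KRep.rot t γ (b 1) (b 2) (b_abs b 1) (b_abs b 2)).smul ((Nice.const (U2_abs hu 1)).mul s0))
    refine (this.mono (by norm_num)).congr ?_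
    intro s _
    have d0 : γ s 0 * b 0 0 + γ s 1 * b 0 1 + γ s 2 * b 0 2 =
        (r + κ * s) * (Real.cos (s * u 1) * Real.cos (s * u 0)) := by
      rw [← nv_dot0 b u s]; simp [hγ]; ring
    have d1 : γ s 0 * b 1 0 + γ s 1 * b 1 1 + γ s 2 * b 1 2 =
        (r + κ * s) * (Real.cos (s * u 1) * Real.sin (s * u 0)) := by
      rw [← nv_dot1 b u s]; simp [hγ]; ring
    have d2 : γ s 0 * b 2 0 + γ s 1 * b 2 1 + γ s 2 * b 2 2 =
        (r + κ * s) * Real.sin (s * u 1) := by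
      rw [← nv_dot2 b u s]; simp [hγ]; ring
    have B := Real.cos_sq_add_sin_sq (s * u 0)
    simp only [d0, d1, d2]
    apply pt_ext <;> simp
    · linear_combination (-(r + κ * s) * Real.cos (s * u 1) * u 1 * b 2 0) * B
    · linear_combination (-(r + κ * s) * Real.cos (s * u 1) * u 1 * b 2 1) * B
    · linear_combination (-(r + κ * s) * Real.cos (s * u 1) * u 1 * b 2 2) * B
  · intro s _
    have C0 : HasDerivAt (fun s => Real.cos (s * u 0)) _ s := (hasDerivAt_mul_const (u 0)).cos
    have S0 : HasDerivAt (fun s => Real.sin (s * u 0)) _ s := (hasDerivAt_mul_const (u 0)).sin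
    have C1 : HasDerivAt (fun s => Real.cos (s * u 1)) _ s := (hasDerivAt_mul_const (u 1)).cos
    have S1 : HasDerivAt (fun s => Real.sin (s * u 1)) _ s := (hasDerivAt_mul_const (u 1)).sin
    have hr : HasDerivAt (fun s => r + κ * s) κ s := by
      simpa using ((hasDerivAt_id s).const_mul κ).const_add r
    have := hr.smul ((((C1.mul C0).smul_const (b 0)).add ((C1.mul S0).smul_const (b 1))).add (S1.smul_const (b 2)))
    refine HasDerivAt.congr_deriv this ?_
    rw [add_comm]
    rfl

lemma PP_nv (b : OrthonormalBasis (Fin 3) ℝ E3) (u : Fin 2 → ℝ) (r κ s : ℝ) :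
    PP b ((fun y : Fin 3 → ℝ => ![(r + κ * y 0) * (Real.cos (y 0 * y 2) * Real.cos (y 0 * y 1)),
      (r + κ * y 0) * (Real.cos (y 0 * y 2) * Real.sin (y 0 * y 1)),
      (r + κ * y 0) * Real.sin (y 0 * y 2)]) (Fin.cons s u)) = (r + κ * s) • nv b u s := by
  rw [PP_apply]
  simp [nv, cons0, cons1, cons2, smul_add, smul_smul]

theorem sphere (b : OrthonormalBasis (Fin 3) ℝ E3) (r κ t : ℝ) (x : E3) (hx : x = r • b 0)
    (hr : 0 < r) (hκ : κ ≠ 0) (hκr : ∀ s ∈ Icc (0:ℝ) 1, r / 2 ≤ r + κ * s)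
    (hrad : ∀ u ∈ U2, KRep 1000 t (fun s => (r + κ * s) • nv b u s) (fun s => (0, κ • nv b u s)))
    {φ : Pt → ℝ} (h : Good φ) :
    (r ^ 2 / 8 * |κ|) * φ (t, x) ^ 2 ≤ (7 * (132 * (10000:ℝ) ^ 2)) ^ 2 * En φ t ^ 2 := by
  have hQ : ∀ y ∈ Q3, ∀ i, 0 < y i ∧ y i < 1 := fun y hy i => hy i (mem_univ _)
  have hang : ∀ y ∈ Q3, ∀ i, 0 < y 0 * y i ∧ y 0 * y i < 1 := by
    intro y hy i
    have h0 := hQ y hy 0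
    have h1 := hQ y hy i
    exact ⟨mul_pos h0.1 h1.1, by nlinarith⟩
  refine area b (fun y : Fin 3 → ℝ => ![(r + κ * y 0) * (Real.cos (y 0 * y 2) * Real.cos (y 0 * y 1)),
      (r + κ * y 0) * (Real.cos (y 0 * y 2) * Real.sin (y 0 * y 1)),
      (r + κ * y 0) * Real.sin (y 0 * y 2)])
    (fun y => !![κ * (Real.cos (y 0 * y 2) * Real.cos (y 0 * y 1)) + (r + κ * y 0) *
        (-Real.sin (y 0 * y 2) * y 2 * Real.cos (y 0 * y 1) - Real.cos (y 0 * y 2) * Real.sin (y 0 * y 1) * y 1),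
        -(r + κ * y 0) * Real.cos (y 0 * y 2) * Real.sin (y 0 * y 1) * y 0,
        -(r + κ * y 0) * Real.sin (y 0 * y 2) * Real.cos (y 0 * y 1) * y 0;
        κ * (Real.cos (y 0 * y 2) * Real.sin (y 0 * y 1)) + (r + κ * y 0) *
        (-Real.sin (y 0 * y 2) * y 2 * Real.sin (y 0 * y 1) + Real.cos (y 0 * y 2) * Real.cos (y 0 * y 1) * y 1),
        (r + κ * y 0) * Real.cos (y 0 * y 2) * Real.cos (y 0 * y 1) * y 0,
        -(r + κ * y 0) * Real.sin (y 0 * y 2) * Real.sin (y 0 * y 1) * y 0;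
        κ * Real.sin (y 0 * y 2) + (r + κ * y 0) * (Real.cos (y 0 * y 2) * y 2), 0,
        (r + κ * y 0) * Real.cos (y 0 * y 2) * y 0])
    (r ^ 2 / 8 * |κ|) 10000 t x (by positivity) (by norm_num) ?_ ?_ ?_ ?_ ?_ h
  · intro y _
    apply hasFDerivAt_mat
    have hρ := ((hc y 0).const_mul κ).const_add r
    have ha := (hc y 0).mul (hc y 2)
    have hb := (hc y 0).mul (hc y 1)
    intro i
    fin_cases i
    · exact ⟨_, hρ.mul (ha.cos.mul hb.cos), fun v => by simp; ring⟩
    · exact ⟨_, hρ.mul (ha.cos.mul hb.sin), fun v => by simp; ring⟩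
    · exact ⟨_, hρ.mul ha.sin, fun v => by simp; ring⟩
  · intro y hy
    have A := Real.cos_sq_add_sin_sq (y 0 * y 2)
    have B := Real.cos_sq_add_sin_sq (y 0 * y 1)
    have hdet : ∀ M : Matrix (Fin 3) (Fin 3) ℝ, M = (!![κ * (Real.cos (y 0 * y 2) * Real.cos (y 0 * y 1)) + (r + κ * y 0) *
        (-Real.sin (y 0 * y 2) * y 2 * Real.cos (y 0 * y 1) - Real.cos (y 0 * y 2) * Real.sin (y 0 * y 1) * y 1),
        -(r + κ * y 0) * Real.cos (y 0 * y 2) * Real.sin (y 0 * y 1) * y 0,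
        -(r + κ * y 0) * Real.sin (y 0 * y 2) * Real.cos (y 0 * y 1) * y 0;
        κ * (Real.cos (y 0 * y 2) * Real.sin (y 0 * y 1)) + (r + κ * y 0) *
        (-Real.sin (y 0 * y 2) * y 2 * Real.sin (y 0 * y 1) + Real.cos (y 0 * y 2) * Real.cos (y 0 * y 1) * y 1),
        (r + κ * y 0) * Real.cos (y 0 * y 2) * Real.cos (y 0 * y 1) * y 0,
        -(r + κ * y 0) * Real.sin (y 0 * y 2) * Real.sin (y 0 * y 1) * y 0;
        κ * Real.sin (y 0 * y 2) + (r + κ * y 0) * (Real.cos (y 0 * y 2) * y 2), 0,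
        (r + κ * y 0) * Real.cos (y 0 * y 2) * y 0] : Matrix (Fin 3) (Fin 3) ℝ) →
        M.det = κ * ((r + κ * y 0) ^ 2 * y 0 ^ 2 * Real.cos (y 0 * y 2)) := by
      intro M hM
      rw [hM, Matrix.det_fin_three]
      simp
      linear_combination (κ * (r + κ * y 0) ^ 2 * y 0 ^ 2 * Real.cos (y 0 * y 2)) *
        ((Real.cos (y 0 * y 1) ^ 2 + Real.sin (y 0 * y 1) ^ 2) * A + B)
    rw [hdet _ rfl]
    have h0 := hQ y hy 0
    have h2 := hang y hy 2
    have hcos : 1 / 2 ≤ Real.cos (y 0 * y 2) := by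
      refine le_trans ?_ (Real.one_sub_sq_div_two_le_cos)
      nlinarith
    have hρ := hκr (y 0) ⟨h0.1.le, h0.2.le⟩
    rw [abs_mul]
    have hp : 0 ≤ (r + κ * y 0) ^ 2 * y 0 ^ 2 * Real.cos (y 0 * y 2) := by positivity
    rw [abs_of_nonneg hp]
    have h4 : (r / 2) ^ 2 ≤ (r + κ * y 0) ^ 2 := by gcongr
    have h5 : (r / 2) ^ 2 * y 0 ^ 2 * (1 / 2) ≤ (r + κ * y 0) ^ 2 * y 0 ^ 2 * Real.cos (y 0 * y 2) := by
      gcongr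
    calc y 0 ^ 2 * (r ^ 2 / 8 * |κ|) = |κ| * ((r / 2) ^ 2 * y 0 ^ 2 * (1 / 2)) := by ring
      _ ≤ _ := by gcongr
  · intro y hy z hz e
    have e0 := congrFun e 0
    have e1 := congrFun e 1
    have e2 := congrFun e 2
    simp only [Matrix.cons_val_zero, Matrix.cons_val_one, Matrix.cons_val] at e0 e1 e2
    have hy0 := hQ y hy 0
    have hz0 := hQ z hz 0
    have ρy := hκr (y 0) ⟨hy0.1.le, hy0.2.le⟩
    have ρz := hκr (z 0) ⟨hz0.1.le, hz0.2.le⟩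
    have Ay := Real.cos_sq_add_sin_sq (y 0 * y 2)
    have By := Real.cos_sq_add_sin_sq (y 0 * y 1)
    have Az := Real.cos_sq_add_sin_sq (z 0 * z 2)
    have Bz := Real.cos_sq_add_sin_sq (z 0 * z 1)
    have hy2 := hang y hy 2
    have hz2 := hang z hz 2
    have hy1 := hang y hy 1
    have hz1 := hang z hz 1
    have pi3 := Real.pi_gt_three
    have sqe : ∀ w : Fin 3 → ℝ, (r + κ * w 0) ^ 2 =
        ((r + κ * w 0) * (Real.cos (w 0 * w 2) * Real.cos (w 0 * w 1))) ^ 2 +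
        ((r + κ * w 0) * (Real.cos (w 0 * w 2) * Real.sin (w 0 * w 1))) ^ 2 +
        ((r + κ * w 0) * Real.sin (w 0 * w 2)) ^ 2 := by
      intro w
      have A := Real.cos_sq_add_sin_sq (w 0 * w 2)
      have B := Real.cos_sq_add_sin_sq (w 0 * w 1)
      linear_combination -(r + κ * w 0) ^ 2 * (Real.cos (w 0 * w 2) ^ 2 * B + A)
    have hsq : (r + κ * y 0) ^ 2 = (r + κ * z 0) ^ 2 := by
      rw [sqe y, sqe z, e0, e1, e2]
    have hρ : r + κ * y 0 = r + κ * z 0 := by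
      rwa [sq_eq_sq₀ (by linarith) (by linarith)] at hsq
    have h0 : y 0 = z 0 := by
      have : κ * y 0 = κ * z 0 := by linarith
      exact mul_left_cancel₀ hκ this
    have hρz : r + κ * z 0 ≠ 0 := by linarith
    rw [hρ] at e0 e1 e2
    have e2' := mul_left_cancel₀ hρz e2
    have e0' := mul_left_cancel₀ hρz e0
    have h2 : y 0 * y 2 = z 0 * z 2 :=
      Real.injOn_sin ⟨by linarith, by linarith⟩ ⟨by linarith, by linarith⟩ e2'
    rw [h2] at e0'
    have hcz : Real.cos (z 0 * z 2) ≠ 0 :=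
      (Real.cos_pos_of_mem_Ioo ⟨by linarith, by linarith⟩).ne'
    have h1 : y 0 * y 1 = z 0 * z 1 :=
      Real.injOn_cos ⟨by linarith, by linarith⟩ ⟨by linarith, by linarith⟩ (mul_left_cancel₀ hcz e0')
    rw [h0] at h1 h2
    ext i
    fin_cases i
    · exact h0
    · exact mul_left_cancel₀ hz0.1.ne' h1
    · exact mul_left_cancel₀ hz0.1.ne' h2
  · intro u hu
    simp only [PP_nv]
    exact curve_adm b hu r κ t (hrad u hu)
  · intro u hu
    rw [PP_nv, hx]
    simp [nv]

lemma exists_basis (x : E3) (hx : x ≠ 0) : ∃ b : OrthonormalBasis (Fin 3) ℝ E3, x = ‖x‖ • b 0 := by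
  have hn : ‖x‖ ≠ 0 := norm_ne_zero_iff.2 hx
  obtain ⟨b, hb⟩ := Orthonormal.exists_orthonormalBasis_extension_of_card_eq (𝕜 := ℝ) (E := E3) (ι := Fin 3)
    (by simp) (v := fun _ => ‖x‖⁻¹ • x) (s := {0}) (by
      constructor
      · intro i
        simp [norm_smul, hn]
      · intro i j hij
        exact absurd (Subsingleton.elim i j) hij)
  refine ⟨b, ?_⟩
  rw [hb 0 rfl, smul_smul, mul_inv_cancel₀ hn, one_smul]

theorem region2a (x : E3) (t : ℝ) (hx : 0 < ‖x‖) {φ : Pt → ℝ} (h : Good φ) :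
    (‖x‖ ^ 2 / 8 * |(1:ℝ)|) * φ (t, x) ^ 2 ≤ (7 * (132 * (10000:ℝ) ^ 2)) ^ 2 * En φ t ^ 2 := by
  obtain ⟨b, hb⟩ := exists_basis x (norm_pos_iff.1 hx)
  refine sphere b ‖x‖ 1 t x hb hx one_ne_zero (fun s hs => by linarith [hs.1]) ?_ h
  intro u hu
  set γ : ℝ → E3 := fun s => (‖x‖ + 1 * s) • nv b u s
  have := (((KRep.basic t γ 1).smul (nv_nice b hu 0)).add
    ((KRep.basic t γ 2).smul (nv_nice b hu 1))).add
    ((KRep.basic t γ 3).smul (nv_nice b hu 2))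
  refine (this.mono (by norm_num)).congr ?_
  intro s _
  apply pt_ext <;> simp [KV1, KV2, KV3, ee_apply]

theorem region2b (x : E3) (t : ℝ) (ht : 0 ≤ t) (hx : 0 < ‖x‖) (hxt : t ≤ 2 * ‖x‖) (hne : ‖x‖ ≠ t)
    {φ : Pt → ℝ} (h : Good φ) :
    (‖x‖ ^ 2 / 8 * |(‖x‖ - t) / 2|) * φ (t, x) ^ 2 ≤ (7 * (132 * (10000:ℝ) ^ 2)) ^ 2 * En φ t ^ 2 := by
  obtain ⟨b, hb⟩ := exists_basis x (norm_pos_iff.1 hx)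
  set r := ‖x‖ with hr
  have hρ : ∀ s ∈ Icc (0:ℝ) 1, r / 2 ≤ r + (r - t) / 2 * s := by
    intro s hs
    have h1 := hs.1
    have h2 := hs.2
    nlinarith
  refine sphere b r ((r - t) / 2) t x hb hx (div_ne_zero (sub_ne_zero.2 hne) two_ne_zero) hρ ?_ h
  intro u hu
  set γ : ℝ → E3 := fun s => (r + (r - t) / 2 * s) • nv b u s with hγ
  have nk : Nice 1 (fun s => (1 + s / 2)⁻¹) := by
    refine Nice.of_deriv (fun s => -(1 / 2) / (1 + s / 2) ^ 2) ?_ ?_ ?_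
    · intro s hs
      exact (((hasDerivAt_id s).div_const 2).const_add 1).inv (by simp; linarith [hs.1])
    · intro s hs
      have := hs.1
      rw [abs_of_pos (by positivity)]
      exact inv_le_one_of_one_le₀ (by linarith)
    · intro s hs
      have := hs.1
      rw [abs_div, abs_neg, abs_of_pos (by norm_num : (0:ℝ) < 1 / 2), abs_of_pos (by positivity),
        div_le_one (by positivity)]
      nlinarith
  have na : Nice 1 (fun s => t / (t + (r + (r - t) / 2 * s))) := by
    refine Nice.of_deriv (fun s => -(t * ((r - t) / 2)) / (t + (r + (r - t) / 2 * s)) ^ 2) ?_ ?_ ?_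
    · intro s hs
      have h1 := hρ s hs
      have hd : HasDerivAt (fun s => t + (r + (r - t) / 2 * s)) ((r - t) / 2) s := by
        simpa using (((hasDerivAt_id s).const_mul ((r - t) / 2)).const_add r).const_add t
      have := (hasDerivAt_const s t).div hd (by linarith)
      refine HasDerivAt.congr_deriv this ?_
      ring
    · intro s hs
      have h1 := hρ s hs
      rw [abs_of_nonneg (div_nonneg ht (by linarith)), div_le_one (by linarith)]
      linarith
    · intro s hs
      have h1 := hρ s hs
      rw [abs_div, abs_neg, abs_mul, abs_of_nonneg ht, abs_of_nonneg (sq_nonneg (t + (r + (r - t) / 2 * s))),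
        div_le_one (by apply pow_pos; linarith)]
      have h2 : |(r - t) / 2| ≤ t + (r + (r - t) / 2 * s) := by
        rw [abs_le]; constructor <;> linarith
      rw [sq]
      refine mul_le_mul (by linarith) h2 (abs_nonneg _) (by linarith)
  have nA : ∀ i, Nice 40 (fun s => (-(1 / 2)) * ((1 + s / 2)⁻¹ * (t / (t + (r + (r - t) / 2 * s)))) * nv b u s i) :=
    fun i => (((Nice.const (K := 1 / 2) (by norm_num : |(-(1 / 2) : ℝ)| ≤ 1 / 2)).mul (nk.mul na)).mul (nv_nice b hu i)).mono (by norm_num)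
  have nB : Nice 4 (fun s => (1 / 2) * ((1 + s / 2)⁻¹ * (1 + - (t / (t + (r + (r - t) / 2 * s)))))) :=
    ((Nice.const (K := 1 / 2) (by norm_num : |((1 / 2) : ℝ)| ≤ 1 / 2)).mul (nk.mul
      ((Nice.const (K := 1) (by norm_num : |(1 : ℝ)| ≤ 1)).add na.neg))).mono (by norm_num)
  have := ((((KRep.basic t γ 8).smul (nA 0)).add ((KRep.basic t γ 9).smul (nA 1))).add
    ((KRep.basic t γ 10).smul (nA 2))).add
    ((KRep.basic t γ 4).smul nB)
  refine (this.mono (by norm_num)).congr ?_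
  intro s hs
  have h1 := hρ s hs
  have hN := nv_sq b u s
  have hs0 : 1 + s / 2 ≠ 0 := by linarith [hs.1]
  have hk : (1 + s / 2)⁻¹ * (1 + s / 2) = 1 := inv_mul_cancel₀ hs0
  have hα : t / (t + (r + (r - t) / 2 * s)) * (t + (r + (r - t) / 2 * s)) = t :=
    div_mul_cancel₀ _ (by linarith)
  set k := (1 + s / 2)⁻¹
  set α := t / (t + (r + (r - t) / 2 * s))
  apply pt_ext <;> simp [KV4, KV8, KV9, KV10, ee_apply, hγ]
  · linear_combination (1 / 2 * k * α * (r + (r - t) / 2 * s)) * hN + (1 / 2 * k) * hα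
  · linear_combination (1 / 2 * k * nv b u s 0) * hα - ((r - t) / 2 * nv b u s 0) * hk
  · linear_combination (1 / 2 * k * nv b u s 1) * hα - ((r - t) / 2 * nv b u s 1) * hk
  · linear_combination (1 / 2 * k * nv b u s 2) * hα - ((r - t) / 2 * nv b u s 2) * hk

lemma weight_case (w J C E f : ℝ) (hw : w ^ 2 ≤ 6400 * J) (hC : 0 ≤ C) (hE : 0 ≤ E)
    (h : J * f ^ 2 ≤ C ^ 2 * E ^ 2) : w * |f| ≤ 80 * C * E := by
  apply abs_le_of_sq_le_sq' _ (by positivity) |>.2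
  rw [mul_pow, sq_abs]
  nlinarith [mul_le_mul_of_nonneg_right hw (sq_nonneg f)]
/-- Klainerman–Sobolev inequality: there is a universal constant `C` such that
for every smooth `φ` on `ℝ^{1+3}` vanishing for large `|x|`,
`(1+t+|x|)(1+|t-|x||)^{1/2} |φ(t,x)| ≤ C Σ_{|I|≤2} ‖Z^I φ(t,·)‖_{L²(ℝ³)}`. -/
theorem klainerman_sobolev :
    ∃ C > 0, ∀ φ : Pt → ℝ, ContDiff ℝ (⊤ : ℕ∞) φ →
      (∃ M : ℝ, ∀ p : Pt, M ≤ ‖p.2‖ → φ p = 0) →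
      ∀ (t : ℝ) (x : EuclideanSpace ℝ (Fin 3)), 0 ≤ t →
        (1 + t + ‖x‖) * Real.sqrt (1 + |t - ‖x‖|) * |φ (t, x)| ≤
          C * (L2n φ t
            + (CVFs.map (fun Z => L2n (Z φ) t)).sum
            + (CVFs.map (fun Z₁ =>
                (CVFs.map (fun Z₂ => L2n (Z₁ (Z₂ φ)) t)).sum)).sum) := by
  refine ⟨80 * (7 * (132 * (10000:ℝ) ^ 2)), by norm_num, ?_⟩
  intro φ hφ hM t x ht
  have h : Good φ := ⟨hφ, hM⟩
  rw [← En_eq]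
  have hE := En_nonneg φ t
  have hr := norm_nonneg x
  have hsq : ((1 + t + ‖x‖) * Real.sqrt (1 + |t - ‖x‖|)) ^ 2 =
      (1 + t + ‖x‖) ^ 2 * (1 + |t - ‖x‖|) := by
    rw [mul_pow, Real.sq_sqrt (by positivity)]
  have hab : |t - ‖x‖| ≤ t + ‖x‖ := by
    rw [abs_le]; constructor <;> linarith
  have reg2 : 1 / 2 ≤ ‖x‖ → t ≤ 2 * ‖x‖ →
      (1 + t + ‖x‖) * Real.sqrt (1 + |t - ‖x‖|) * |φ (t, x)| ≤
        80 * (7 * (132 * (10000:ℝ) ^ 2)) * En φ t := by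
    intro h1 h2
    have h3 : (1 + t + ‖x‖) ^ 2 ≤ (5 * ‖x‖) ^ 2 := by
      gcongr; linarith
    by_cases h4 : |t - ‖x‖| ≤ 1
    · refine weight_case _ _ _ _ _ ?_ (by norm_num) hE (region2a x t (by linarith) h)
      rw [hsq, abs_one]
      calc _ ≤ (5 * ‖x‖) ^ 2 * (1 + 1) := by gcongr
        _ ≤ _ := by nlinarith [sq_nonneg ‖x‖]
    · push Not at h4
      refine weight_case _ _ _ _ _ ?_ (by norm_num) hE (region2b x t ht (by linarith) h2 ?_ h)
      · rw [hsq, abs_div, abs_sub_comm ‖x‖ t, abs_two]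
        calc _ ≤ (5 * ‖x‖) ^ 2 * (|t - ‖x‖| + |t - ‖x‖|) := by gcongr
          _ ≤ _ := by nlinarith [mul_nonneg (sq_nonneg ‖x‖) (abs_nonneg (t - ‖x‖))]
      · intro e
        rw [e] at h4
        norm_num at h4
  by_cases h1 : 1 ≤ t
  · by_cases h2 : ‖x‖ ≤ t / 2
    · refine weight_case _ _ _ _ _ ?_ (by norm_num) hE (region1 x t h1 h2 h)
      rw [hsq]
      calc _ ≤ (5 / 2 * t) ^ 2 * (2 * t) := by
            gcongr
            · linarith
            · have : |t - ‖x‖| ≤ t := by rw [abs_le]; constructor <;> linarith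
              linarith
        _ ≤ _ := by nlinarith [pow_nonneg ht 3]
    · exact reg2 (by linarith) (by linarith)
  · by_cases h2 : ‖x‖ ≤ 1 / 2
    · refine weight_case _ _ _ _ _ ?_ (by norm_num) hE (region0 x t h)
      rw [hsq]
      calc _ ≤ (5 / 2 : ℝ) ^ 2 * (1 + 3 / 2) := by
            gcongr <;> linarith
        _ ≤ _ := by norm_num
    · exact reg2 (by linarith) (by linarith)

end
end
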